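/- arXiv:2307.06113 — 3 statements merged into one kernel-verified Lean document; each statement's English description precedes it below -/
import Mathlib

section
/- Suppose there is a (possibly randomized) algorithm that, on a uniformly random simple d-regular graph on n vertices, makes at most q node-incidence queries and reports a valid s-t path (s = 1, t = n) with probability α. Then there is a constant c(d) ≥ exp(−O(d²)) and a deterministic algorithm that, on a uniformly random perfect matching G drawn from M_{n,d}, makes at most q group-incidence queries and reports a valid s-t meta-path with probability at least c(d)·α. -/
/-- `M_{n,d}`: perfect matchings on the vertex set `[n] × [d]`, encoded as fixed-point-free
involutions (each vertex is matched to its image).  The set `{i} × [d]` is called group `i`. -/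
abbrev PMatching (n d : ℕ) :=
  {f : Fin n × Fin d → Fin n × Fin d // Function.Involutive f ∧ ∀ x, f x ≠ x}

/-- The probability of the event `E` for a uniformly random perfect matching
drawn from `M_{n,d}`. -/
noncomputable def mProb (n d : ℕ) (E : PMatching n d → Prop) : ℝ :=
  (Nat.card {f : PMatching n d // E f} : ℝ) / (Nat.card (PMatching n d) : ℝ)

/-- A deterministic adaptive group-incidence query algorithm: `nextQuery` selects the next
group to query from the transcript so far (the list of queried groups together with the
answers; the answer to a query at group `i` is the set of matching edges incident to group
`i`, recorded as the function `j ↦ f (i, j)`), and `output` produces a sequence of group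
indices (a meta-path) from the full transcript. -/
structure MAlgo (n d : ℕ) where
  nextQuery : List (Fin n × (Fin d → Fin n × Fin d)) → Fin n
  output : List (Fin n × (Fin d → Fin n × Fin d)) → List (Fin n)

/-- The transcript of the first `q` group-incidence queries of `A` run on the matching `f`. -/
def mRun {n d : ℕ} (A : MAlgo n d) (f : PMatching n d) :
    ℕ → List (Fin n × (Fin d → Fin n × Fin d))
  | 0 => []
  | q + 1 =>
      let h := mRun A f q
      h ++ [(A.nextQuery h, fun j => f.1 (A.nextQuery h, j))]

/-- Groups `a` and `b` are joined by a matching edge of `f`: some vertex of group `a` is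
matched to a vertex of group `b`. -/
def metaAdj {n d : ℕ} (f : PMatching n d) (a b : Fin n) : Prop :=
  ∃ j : Fin d, (f.1 (a, j)).1 = b

/-- `L` is a valid `s`-`t` meta-path in the matching `f`: a sequence of group indices
starting at `s` and ending at `t` such that every two consecutive groups are joined by a
matching edge. -/
def IsValidMeta {n d : ℕ} (f : PMatching n d) (s t : Fin n) (L : List (Fin n)) : Prop :=
  L.head? = some s ∧ L.getLast? = some t ∧ L.Chain' (metaAdj f)

/-- Groups `a` and `b` are joined by an edge discovered in the transcript `h`. -/
def discMetaAdj {n d : ℕ} (h : List (Fin n × (Fin d → Fin n × Fin d))) (a b : Fin n) : Prop :=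
  ∃ e ∈ h, ∃ j : Fin d, (e.1 = a ∧ (e.2 j).1 = b) ∨ (e.1 = b ∧ (e.2 j).1 = a)

/-- A simple `d`-regular graph on vertex set `Fin n`, encoded as a symmetric irreflexive
Boolean adjacency matrix in which every vertex has exactly `d` neighbors. -/
abbrev RegGraph (n d : ℕ) :=
  {g : Fin n → Fin n → Bool //
    (∀ u v, g u v = g v u) ∧ (∀ v, g v v = false) ∧
      ∀ v, (Finset.univ.filter fun u => g v u = true).card = d}

/-- The probability of the event `E` for a uniformly random simple `d`-regular graph on
`n` vertices. -/
noncomputable def regProb (n d : ℕ) (E : RegGraph n d → Prop) : ℝ :=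
  (Nat.card {g : RegGraph n d // E g} : ℝ) / (Nat.card (RegGraph n d) : ℝ)

/-- A deterministic adaptive node-incidence query algorithm: `nextQuery` selects the next
vertex to query from the transcript so far (the list of queried vertices together with the
answers, each answer being the neighborhood of the queried vertex, i.e. the set of edges
incident to it), and `output` produces a vertex sequence from the full transcript. -/
structure NAlgo (n : ℕ) where
  nextQuery : List (Fin n × Finset (Fin n)) → Fin n
  output : List (Fin n × Finset (Fin n)) → List (Fin n)

/-- The transcript of the first `q` node-incidence queries of `A` run on the `d`-regular
graph `g`. -/
def nRun {n d : ℕ} (A : NAlgo n) (g : RegGraph n d) : ℕ → List (Fin n × Finset (Fin n))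
  | 0 => []
  | q + 1 =>
      let h := nRun A g q
      h ++ [(A.nextQuery h, Finset.univ.filter fun u => g.1 (A.nextQuery h) u = true)]

/-- `L` is a valid `s`-`t` path in the graph `g`: it starts at `s`, ends at `t`, and every
pair of consecutive vertices is adjacent in `g`. -/
def IsValidPathReg {n d : ℕ} (g : RegGraph n d) (s t : Fin n) (L : List (Fin n)) : Prop :=
  L.head? = some s ∧ L.getLast? = some t ∧ L.Chain' fun a b => g.1 a b = true

noncomputable def cnt {Om : Type*} (P : Om → Prop) : ℕ := Nat.card {w // P w}

lemma cnt_eq {Om : Type*} [Fintype Om] (P : Om → Prop) [DecidablePred P] :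
    cnt P = (Finset.univ.filter P).card := by
  rw [cnt, Nat.card_eq_fintype_card, Fintype.card_subtype]

lemma cnt_mono {Om : Type*} [Finite Om] {P Q : Om → Prop} (h : ∀ w, P w → Q w) : cnt P ≤ cnt Q := by
  classical
  have := Fintype.ofFinite Om
  rw [cnt_eq, cnt_eq]
  exact Finset.card_le_card (fun w hw => by simp at hw ⊢; exact h w hw)

lemma cnt_false {Om : Type*} {P : Om → Prop} (h : ∀ w, ¬ P w) : cnt P = 0 := by
  have : IsEmpty {w // P w} := ⟨fun w => h w.1 w.2⟩
  simp [cnt]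

open Finset in
lemma lll_step {Om I : Type*} [Fintype Om] [Fintype I] (A : I → Om → Prop) (nbr : I → I → Prop)
    [∀ e, DecidablePred (nbr e)]
    (p : I → ℝ) (hp : ∀ e, 0 ≤ p e) :
    (∀ e (S : Finset I), (∀ f ∈ S, ¬ nbr e f) →
      ((cnt fun w => A e w ∧ ∀ f ∈ S, ¬ A f w) : ℝ) ≤
        p e * (cnt fun w => ∀ f ∈ S, ¬ A f w)) →
    (∀ e, ∑ f ∈ univ.filter (nbr e), p f ≤ 1 / 4) →
    ∀ (S : Finset I) (e : I),
      ((cnt fun w => A e w ∧ ∀ f ∈ S, ¬ A f w) : ℝ) ≤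
        2 * p e * (cnt fun w => ∀ f ∈ S, ¬ A f w) := by
  classical
  simp only [cnt_eq]
  intro h1 h2 S
  induction S using Finset.strongInduction with
  | H S ih =>
    intro e
    by_cases hS : ∀ f ∈ S, ¬ nbr e f
    · have := h1 e S hS
      have h0 : 0 ≤ p e * ((univ.filter fun w => ∀ f ∈ S, ¬ A f w).card : ℝ) :=
        mul_nonneg (hp e) (Nat.cast_nonneg _)
      nlinarith
    · push Not at hS
      obtain ⟨f0, hf0, hn0⟩ := hS
      set S1 := S.filter (nbr e) with hS1
      set S2 := S.filter (fun f => ¬ nbr e f) with hS2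
      have hss : S2 ⊂ S := by
        refine Finset.filter_ssubset.2 ⟨f0, hf0, by simpa using hn0⟩
      have ih2 := ih S2 hss
      set c2 : ℝ := ((univ.filter fun w => ∀ f ∈ S2, ¬ A f w).card : ℝ) with hc2
      set c : ℝ := ((univ.filter fun w => ∀ f ∈ S, ¬ A f w).card : ℝ) with hc
      have hsub : (univ.filter fun w => ∀ f ∈ S2, ¬ A f w) ⊆
          (univ.filter fun w => ∀ f ∈ S, ¬ A f w) ∪
            S1.biUnion (fun f => univ.filter fun w => A f w ∧ ∀ f ∈ S2, ¬ A f w) := by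
        intro w hw
        simp only [mem_filter, mem_univ, true_and, mem_union, mem_biUnion] at hw ⊢
        by_cases h : ∀ f ∈ S, ¬ A f w
        · exact Or.inl h
        · push Not at h
          obtain ⟨f, hf, ha⟩ := h
          refine Or.inr ⟨f, ?_, ha, hw⟩
          by_contra hcon
          refine hw f ?_ ha
          simp only [hS1, hS2, mem_filter] at hcon ⊢
          exact ⟨hf, fun h => hcon ⟨hf, h⟩⟩
      have hcard : c2 ≤ c + ∑ f ∈ S1, 2 * p f * c2 := by
        have h3 := (Finset.card_le_card hsub).trans (Finset.card_union_le _ _)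
        have h4 : (((S1.biUnion (fun f => univ.filter fun w => A f w ∧ ∀ f ∈ S2, ¬ A f w)).card : ℕ) : ℝ)
            ≤ ∑ f ∈ S1, 2 * p f * c2 := by
          refine le_trans (Nat.cast_le.2 Finset.card_biUnion_le) ?_
          push_cast
          exact Finset.sum_le_sum fun f _ => ih2 f
        have h5 : c2 ≤ c + (((S1.biUnion (fun f => univ.filter fun w => A f w ∧ ∀ f ∈ S2, ¬ A f w)).card : ℕ) : ℝ) := by
          rw [hc2, hc]; exact_mod_cast h3
        linarith
      have hsum : ∑ f ∈ S1, 2 * p f * c2 ≤ c2 / 2 := by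
        have : ∑ f ∈ S1, 2 * p f * c2 = (∑ f ∈ S1, p f) * (2 * c2) := by
          rw [Finset.sum_mul]; exact Finset.sum_congr rfl fun _ _ => by ring
        rw [this]
        have h6 : ∑ f ∈ S1, p f ≤ 1 / 4 := by
          refine le_trans (Finset.sum_le_sum_of_subset_of_nonneg ?_ fun i _ _ => hp i) (h2 e)
          exact Finset.filter_subset_filter _ (Finset.subset_univ _)
        have : 0 ≤ c2 := Nat.cast_nonneg _
        nlinarith
      have h7 : ((univ.filter fun w => A e w ∧ ∀ f ∈ S, ¬ A f w).card : ℝ) ≤ p e * c2 := by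
        refine le_trans (Nat.cast_le.2 (Finset.card_le_card ?_)) (h1 e S2 ?_)
        · intro w hw
          simp only [mem_filter, mem_univ, true_and] at hw ⊢
          exact ⟨hw.1, fun f hf => hw.2 f (Finset.mem_filter.1 hf).1⟩
        · intro f hf; exact (Finset.mem_filter.1 hf).2
      have := hp e
      nlinarith

open Finset in
lemma lll_main {Om I : Type*} [Fintype Om] [Fintype I] (A : I → Om → Prop) (nbr : I → I → Prop)
    [∀ e, DecidablePred (nbr e)]
    (p : I → ℝ) (hp : ∀ e, 0 ≤ p e) (hp4 : ∀ e, p e ≤ 1 / 4) :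
    (∀ e (S : Finset I), (∀ f ∈ S, ¬ nbr e f) →
      ((cnt fun w => A e w ∧ ∀ f ∈ S, ¬ A f w) : ℝ) ≤
        p e * (cnt fun w => ∀ f ∈ S, ¬ A f w)) →
    (∀ e, ∑ f ∈ univ.filter (nbr e), p f ≤ 1 / 4) →
    Real.exp (-(4 * ∑ e, p e)) * (Fintype.card Om : ℝ) ≤
      (cnt fun w => ∀ f, ¬ A f w) := by
  classical
  intro h1 h2
  have hst0 := lll_step A nbr p hp h1 h2
  simp only [cnt_eq] at hst0 ⊢
  have key : ∀ S : Finset I, Real.exp (-(4 * ∑ e ∈ S, p e)) * (Fintype.card Om : ℝ) ≤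
      (univ.filter fun w => ∀ f ∈ S, ¬ A f w).card := by
    intro S
    induction S using Finset.induction_on with
    | empty => simp
    | insert e S he ih =>
      have hst := hst0 S e
      have hsplit : ((univ.filter fun w => ∀ f ∈ S, ¬ A f w).card : ℝ) =
          (univ.filter fun w => A e w ∧ ∀ f ∈ S, ¬ A f w).card +
          (univ.filter fun w => ∀ f ∈ insert e S, ¬ A f w).card := by
        have := Finset.card_filter_add_card_filter_not (s := univ.filter fun w => ∀ f ∈ S, ¬ A f w) (fun w => A e w)
        rw [Finset.filter_filter, Finset.filter_filter] at this
        rw [← this]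
        push_cast
        congr 3
        · ext w; simp [and_comm]
        · ext w; simp [and_comm]
      rw [Finset.sum_insert he]
      have hx : Real.exp (-(4 * p e)) ≤ 1 - 2 * p e := by
        rw [Real.exp_neg, inv_le_iff_one_le_mul₀ (Real.exp_pos _)]
        have h8 := Real.add_one_le_exp (4 * p e)
        have := hp e
        have := hp4 e
        nlinarith
      have : Real.exp (-(4 * (p e + ∑ e ∈ S, p e))) =
        Real.exp (-(4 * p e)) * Real.exp (-(4 * ∑ e ∈ S, p e)) := by
        rw [← Real.exp_add]; congr 1; ring
      rw [this, mul_assoc]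
      calc _ ≤ Real.exp (-(4 * p e)) * ((univ.filter fun w => ∀ f ∈ S, ¬ A f w).card : ℝ) := by gcongr
        _ ≤ (1 - 2 * p e) * ((univ.filter fun w => ∀ f ∈ S, ¬ A f w).card : ℝ) := by gcongr
        _ ≤ _ := by linarith
  simpa using key univ

def conjSwap {n d : ℕ} (f : PMatching n d) (y z : Fin n × Fin d) : PMatching n d :=
  ⟨fun x => Equiv.swap y z (f.1 (Equiv.swap y z x)), by
    intro x; simp [f.2.1 _], by
    intro x h
    have := congrArg (Equiv.swap y z) h
    simp only [Equiv.swap_apply_self] at this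
    exact f.2.2 _ this⟩

lemma conjSwap_conjSwap {n d : ℕ} (f : PMatching n d) (y z : Fin n × Fin d) :
    conjSwap (conjSwap f y z) y z = f := by
  apply Subtype.ext; funext x; simp [conjSwap]

lemma conjSwap_apply {n d : ℕ} (f : PMatching n d) {x y z : Fin n × Fin d} (h : f.1 x = y)
    (hz : z ≠ x) : (conjSwap f y z).1 x = z := by
  have hxy : x ≠ y := by rintro rfl; exact f.2.2 _ h
  simp [conjSwap, Equiv.swap_apply_of_ne_of_ne hxy hz.symm, h]

lemma conjSwap_edge {n d : ℕ} (f : PMatching n d) {x y z u w : Fin n × Fin d} (h : f.1 x = y)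
    (hz : z ≠ x) (hux : u ≠ x) (huy : u ≠ y) (hwx : w ≠ x) (hwy : w ≠ y)
    (hw : (conjSwap f y z).1 u = w) : f.1 u = w := by
  have hxy : x ≠ y := by rintro rfl; exact f.2.2 _ h
  have hyx : f.1 y = x := by rw [← h]; exact f.2.1 x
  have h1 : f.1 (Equiv.swap y z u) = Equiv.swap y z w := by
    rw [← hw]; simp [conjSwap]
  have huz : u ≠ z := by
    rintro rfl
    rw [Equiv.swap_apply_right, hyx] at h1
    have := congrArg (Equiv.swap y u) h1
    rw [Equiv.swap_apply_self, Equiv.swap_apply_of_ne_of_ne hxy hz.symm] at this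
    exact hwx this.symm
  rw [Equiv.swap_apply_of_ne_of_ne huy huz] at h1
  have hwz : w ≠ z := by
    rintro rfl
    rw [Equiv.swap_apply_right] at h1
    apply hux
    rw [← f.2.1 u, h1, hyx]
  rwa [Equiv.swap_apply_of_ne_of_ne hwy hwz] at h1

open Finset in
lemma swap_count {n d : ℕ} (P : PMatching n d → Prop) (x y : Fin n × Fin d)
    (T : Finset (Fin n × Fin d)) (hT : x ∉ T)
    (hP : ∀ f, f.1 x = y → P f → ∀ z ∈ T, P (conjSwap f y z)) :
    T.card * (cnt fun f : PMatching n d => f.1 x = y ∧ P f) ≤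
      (cnt fun f : PMatching n d => P f) := by
  classical
  rw [cnt_eq, cnt_eq, ← Finset.card_product]
  apply Finset.card_le_card_of_injOn (fun t => conjSwap t.2 y t.1)
  · rintro ⟨z, f⟩ h
    simp only [coe_product, Set.mem_prod, mem_coe, mem_univ, true_and, coe_filter, Set.mem_ofPred_eq] at h ⊢
    exact hP f h.2.1 h.2.2 z h.1
  · rintro ⟨z, f⟩ h ⟨z', f'⟩ h' heq
    simp only [coe_product, Set.mem_prod, mem_coe, mem_univ, true_and, coe_filter, Set.mem_ofPred_eq] at h h' heq
    have e1 := conjSwap_apply f h.2.1 (z := z) (by rintro rfl; exact hT h.1)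
    have e2 := conjSwap_apply f' h'.2.1 (z := z') (by rintro rfl; exact hT h'.1)
    have : z = z' := by rw [← e1, ← e2, heq]
    subst this
    have := congrArg (fun g => conjSwap g y z) heq
    simp only [conjSwap_conjSwap] at this
    rw [this]

abbrev BadIx (n d : ℕ) := (Fin n × Fin d × Fin d) ⊕ (Fin n × Fin n × Fin d × Fin d × Fin d × Fin d)

def badEv {n d : ℕ} : BadIx n d → PMatching n d → Prop
  | .inl (i, a, b), f => f.1 (i, a) = (i, b)
  | .inr (i, j, a, b, a', b'), f =>
      i ≠ j ∧ a ≠ a' ∧ f.1 (i, a) = (j, b) ∧ f.1 (i, a') = (j, b')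

def badSupp {n d : ℕ} : BadIx n d → Finset (Fin n × Fin d)
  | .inl (i, a, b) => {(i, a), (i, b)}
  | .inr (i, j, a, b, a', b') => {(i, a), (j, b), (i, a'), (j, b')}

noncomputable def badP {n d : ℕ} : BadIx n d → ℝ
  | .inl _ => 2 / ((n : ℝ) * d)
  | .inr _ => 2 / ((n : ℝ) * d) ^ 2

lemma badP_nonneg {n d : ℕ} (e : BadIx n d) : 0 ≤ badP e := by
  rcases e with e | e <;> simp only [badP] <;> positivity

lemma badEv_conj {n d : ℕ} (f : PMatching n d) {x y z : Fin n × Fin d} (h : f.1 x = y)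
    (hz : z ≠ x) (g : BadIx n d) (hx : x ∉ badSupp g) (hy : y ∉ badSupp g)
    (hg : badEv g (conjSwap f y z)) : badEv g f := by
  rcases g with ⟨i, a, b⟩ | ⟨i, j, a, b, a', b'⟩
  · simp only [badSupp, Finset.mem_insert, Finset.mem_singleton, not_or] at hx hy
    exact conjSwap_edge f h hz (Ne.symm hx.1) (Ne.symm hy.1) (Ne.symm hx.2) (Ne.symm hy.2) hg
  · simp only [badSupp, Finset.mem_insert, Finset.mem_singleton, not_or] at hx hy
    obtain ⟨h1, h2, h3, h4⟩ := hg
    exact ⟨h1, h2, conjSwap_edge f h hz (Ne.symm hx.1) (Ne.symm hy.1) (Ne.symm hx.2.1) (Ne.symm hy.2.1) h3,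
      conjSwap_edge f h hz (Ne.symm hx.2.2.1) (Ne.symm hy.2.2.1) (Ne.symm hx.2.2.2) (Ne.symm hy.2.2.2) h4⟩

lemma av_conj {n d : ℕ} (f : PMatching n d) {x y z : Fin n × Fin d} (h : f.1 x = y)
    (hz : z ≠ x) (S : Finset (BadIx n d)) (hx : ∀ g ∈ S, x ∉ badSupp g) (hy : ∀ g ∈ S, y ∉ badSupp g)
    (hS : ∀ g ∈ S, ¬ badEv g f) : ∀ g ∈ S, ¬ badEv g (conjSwap f y z) :=
  fun g hg hb => hS g hg (badEv_conj f h hz g (hx g hg) (hy g hg) hb)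

open Finset in
lemma neg_dep {n d : ℕ} (hm : 8 ≤ n * d) (e : BadIx n d) (S : Finset (BadIx n d))
    (hS : ∀ g ∈ S, ¬ ¬ Disjoint (badSupp e) (badSupp g)) :
    ((cnt fun w => badEv e w ∧ ∀ f ∈ S, ¬ badEv f w) : ℝ) ≤
        badP e * (cnt fun w => ∀ f ∈ S, ¬ badEv f w) := by
  classical
  have hS' : ∀ x ∈ badSupp e, ∀ g ∈ S, x ∉ badSupp g := by
    intro x hx g hg
    exact Finset.disjoint_left.1 (not_not.1 (hS g hg)) hx
  have hmR : (8 : ℝ) ≤ (n : ℝ) * d := by exact_mod_cast hm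
  have hone : ∀ x y : Fin n × Fin d, x ∈ badSupp e → y ∈ badSupp e →
      ((n : ℝ) * d - 1) * ((cnt fun f : PMatching n d => f.1 x = y ∧ ∀ g ∈ S, ¬ badEv g f) : ℝ)
        ≤ (cnt fun w => ∀ f ∈ S, ¬ badEv f w) := by
    intro x y hx hy
    have h := swap_count (fun f => ∀ g ∈ S, ¬ badEv g f) x y (univ.erase x) (by simp)
      (fun f hf hP z hz => av_conj f hf (Finset.ne_of_mem_erase hz) S (hS' x hx) (hS' y hy) hP)
    rw [Finset.card_erase_of_mem (mem_univ _), Finset.card_univ, Fintype.card_prod, Fintype.card_fin,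
      Fintype.card_fin] at h
    have h' := (Nat.cast_le (α := ℝ)).2 h
    rw [Nat.cast_mul, Nat.cast_sub (by omega)] at h'
    push_cast at h'
    exact h'
  rcases e with ⟨i, a, b⟩ | ⟨i, j, a, b, a', b'⟩
  · have h := hone (i, a) (i, b) (by simp [badSupp]) (by simp [badSupp])
    change ((cnt fun f : PMatching n d => f.1 (i,a) = (i,b) ∧ ∀ g ∈ S, ¬ badEv g f) : ℝ) ≤ 2 / ((n : ℝ) * d) * _
    rw [div_mul_eq_mul_div, le_div_iff₀ (by linarith)]
    have : (0:ℝ) ≤ ((cnt fun f : PMatching n d => f.1 (i,a) = (i,b) ∧ ∀ g ∈ S, ¬ badEv g f) : ℝ) := Nat.cast_nonneg _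
    nlinarith
  · by_cases hij : i = j
    · rw [cnt_false (fun w hw => hw.1.1 hij)]
      have := badP_nonneg (.inr (i, j, a, b, a', b') : BadIx n d)
      simp only [Nat.cast_zero]
      positivity
    by_cases haa : a = a'
    · rw [cnt_false (fun w hw => hw.1.2.1 haa)]
      have := badP_nonneg (.inr (i, j, a, b, a', b') : BadIx n d)
      simp only [Nat.cast_zero]
      positivity
    have h := hone (i, a) (j, b) (by simp [badSupp]) (by simp [badSupp])
    have h2 := swap_count (fun f => f.1 (i, a) = (j, b) ∧ ∀ g ∈ S, ¬ badEv g f) (i, a') (j, b')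
      (((univ.erase (i, a)).erase (j, b)).erase (i, a')) (by simp)
      (by
        rintro f hf ⟨hP1, hP2⟩ z hz
        simp only [mem_erase, mem_univ, and_true] at hz
        refine ⟨?_, av_conj f hf hz.1 S (hS' _ (by simp [badSupp])) (hS' _ (by simp [badSupp])) hP2⟩
        have hbb : (j, b) ≠ (j, b') := by
          intro hb
          have : f.1 (i, a) = f.1 (i, a') := by rw [hP1, hf, hb]
          have := f.2.1.injective this
          simp at this; exact haa this
        have hx1 : (i, a) ≠ (j, b') := by simp [hij]
        simp only [conjSwap]
        rw [Equiv.swap_apply_of_ne_of_ne hx1 (Ne.symm hz.2.2), hP1,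
          Equiv.swap_apply_of_ne_of_ne hbb (Ne.symm hz.2.1)])
    have hc : n * d - 3 ≤ (((univ.erase (i, a)).erase (j, b)).erase (i, a')).card := by
      have h1 := Finset.pred_card_le_card_erase (s := (univ.erase (i, a)).erase (j, b)) (a := (i, a'))
      have h2 := Finset.pred_card_le_card_erase (s := (univ.erase (i, a))) (a := (j, b))
      have h3 := Finset.pred_card_le_card_erase (s := (univ : Finset (Fin n × Fin d))) (a := (i, a))
      rw [Finset.card_univ, Fintype.card_prod, Fintype.card_fin, Fintype.card_fin] at h3
      omega
    have h3 := (Nat.cast_le (α := ℝ)).2 ((Nat.mul_le_mul_right _ hc).trans h2)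
    rw [Nat.cast_mul, Nat.cast_sub (by omega)] at h3
    push_cast at h3
    have h5 : ((cnt fun w => badEv (.inr (i, j, a, b, a', b') : BadIx n d) w ∧ ∀ f ∈ S, ¬ badEv f w) : ℝ) ≤
      (cnt fun f : PMatching n d => f.1 (i, a') = (j, b') ∧ f.1 (i, a) = (j, b) ∧ ∀ g ∈ S, ¬ badEv g f) := by
      refine Nat.cast_le.2 (cnt_mono ?_)
      intro w hw
      exact ⟨hw.1.2.2.2, hw.1.2.2.1, hw.2⟩
    refine h5.trans ?_
    change _ ≤ 2 / ((n : ℝ) * d) ^ 2 * _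
    rw [div_mul_eq_mul_div, le_div_iff₀ (by positivity)]
    set X : ℝ := ((cnt fun f : PMatching n d => f.1 (i, a') = (j, b') ∧ f.1 (i, a) = (j, b) ∧ ∀ g ∈ S, ¬ badEv g f) : ℝ)
    set Y : ℝ := ((cnt fun f : PMatching n d => f.1 (i, a) = (j, b) ∧ ∀ g ∈ S, ¬ badEv g f) : ℝ)
    set m : ℝ := (n : ℝ) * d
    have hX : 0 ≤ X := Nat.cast_nonneg _
    have h6 : (m - 1) * ((m - 3) * X) ≤ (m - 1) * Y := mul_le_mul_of_nonneg_left h3 (by linarith)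
    have h7 : X * m ^ 2 ≤ 2 * ((m - 1) * ((m - 3) * X)) := by
      have : 0 ≤ X * (m ^ 2 - 8 * m + 6) := mul_nonneg hX (by nlinarith)
      nlinarith
    linarith

open Finset in
lemma point_sum {n d : ℕ} (hn : 0 < n) (hd : 0 < d) (v : Fin n × Fin d) :
    ∑ g : BadIx n d, (if v ∈ badSupp g then badP g else 0) ≤ (12 * d / n : ℝ) := by
  obtain ⟨k, c⟩ := v
  have hn' : (0:ℝ) < n := by exact_mod_cast hn
  have hd' : (1:ℝ) ≤ d := by exact_mod_cast hd
  have hd0 : (0:ℝ) < d := by linarith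
  rw [Fintype.sum_sum_type]
  have p1 : (0:ℝ) ≤ 2 / ((n : ℝ) * d) := by positivity
  have p2 : (0:ℝ) ≤ 2 / ((n : ℝ) * d) ^ 2 := by positivity
  have hA : ∑ g : Fin n × Fin d × Fin d, (if (k, c) ∈ badSupp (.inl g : BadIx n d) then badP (.inl g : BadIx n d) else 0)
      ≤ (4 / n : ℝ) := by
    calc _ ≤ ∑ g : Fin n × Fin d × Fin d, ((if k = g.1 then if c = g.2.1 then 2 / ((n : ℝ) * d) else 0 else 0) +
          (if k = g.1 then if c = g.2.2 then 2 / ((n : ℝ) * d) else 0 else 0)) := by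
          refine Finset.sum_le_sum fun g _ => ?_
          obtain ⟨i, a, b⟩ := g
          simp only [badSupp, badP, mem_insert, mem_singleton, Prod.mk.injEq]
          split_ifs <;> first | linarith | (exfalso; tauto)
      _ = 4 / n := by
          simp only [Finset.sum_add_distrib, Fintype.sum_prod_type]
          simp
          field_simp
          norm_num
          try field_simp
          try norm_num
  have hB : ∑ g : Fin n × Fin n × Fin d × Fin d × Fin d × Fin d, (if (k, c) ∈ badSupp (.inr g : BadIx n d) then badP (.inr g : BadIx n d) else 0)
      ≤ (8 * d / n : ℝ) := by
    calc _ ≤ ∑ g : Fin n × Fin n × Fin d × Fin d × Fin d × Fin d,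
        ((if k = g.1 then if c = g.2.2.1 then 2 / ((n : ℝ) * d) ^ 2 else 0 else 0) +
          (if k = g.2.1 then if c = g.2.2.2.1 then 2 / ((n : ℝ) * d) ^ 2 else 0 else 0) +
          (if k = g.1 then if c = g.2.2.2.2.1 then 2 / ((n : ℝ) * d) ^ 2 else 0 else 0) +
          (if k = g.2.1 then if c = g.2.2.2.2.2 then 2 / ((n : ℝ) * d) ^ 2 else 0 else 0)) := by
          refine Finset.sum_le_sum fun g _ => ?_
          obtain ⟨i, j, a, b, a', b'⟩ := g
          simp only [badSupp, badP, mem_insert, mem_singleton, Prod.mk.injEq]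
          split_ifs <;> first | linarith | (exfalso; tauto)
      _ = (8 * d / n : ℝ) := by
          simp only [Finset.sum_add_distrib, Fintype.sum_prod_type]
          simp
          field_simp
          norm_num
          field_simp
          norm_num
          try field_simp
          try ring
  have : (4:ℝ) / n ≤ 4 * d / n := by gcongr; linarith
  have : (12:ℝ) * d / n = 4 * d / n + 8 * d / n := by ring
  linarith

lemma badSupp_card {n d : ℕ} (e : BadIx n d) : (badSupp e).card ≤ 4 := by
  rcases e with ⟨i, a, b⟩ | ⟨i, j, a, b, a', b'⟩
  · exact Finset.card_le_two.trans (by norm_num)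
  · exact Finset.card_le_four

open Finset in
lemma nbr_sum {n d : ℕ} (hd : 0 < d) (hnd : 192 * d ≤ n) (e : BadIx n d) :
    ∑ f ∈ univ.filter (fun g => ¬ Disjoint (badSupp e) (badSupp g)), badP f ≤ 1 / 4 := by
  classical
  have hn : 0 < n := by omega
  have hn' : (0:ℝ) < n := by exact_mod_cast hn
  have h192 : (192:ℝ) * d ≤ n := by exact_mod_cast hnd
  calc _ = ∑ g : BadIx n d, (if ¬ Disjoint (badSupp e) (badSupp g) then badP g else 0) := by
        exact Finset.sum_filter _ _
    _ ≤ ∑ g : BadIx n d, ∑ v ∈ badSupp e, (if v ∈ badSupp g then badP g else 0) := by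
        refine Finset.sum_le_sum fun g _ => ?_
        by_cases h : ¬ Disjoint (badSupp e) (badSupp g)
        · rw [if_pos h]
          obtain ⟨v, hv, hv'⟩ := Finset.not_disjoint_iff.1 h
          refine le_trans ?_ (Finset.single_le_sum (f := fun v => if v ∈ badSupp g then badP g else 0) ?_ hv)
          · simp [hv']
          · intro i _; split_ifs; exacts [badP_nonneg g, le_rfl]
        · rw [if_neg h]
          exact Finset.sum_nonneg fun i _ => by split_ifs; exacts [badP_nonneg g, le_rfl]
    _ = ∑ v ∈ badSupp e, ∑ g : BadIx n d, (if v ∈ badSupp g then badP g else 0) := Finset.sum_comm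
    _ ≤ ∑ v ∈ badSupp e, (12 * d / n : ℝ) := Finset.sum_le_sum fun v _ => point_sum hn hd v
    _ = (badSupp e).card * (12 * d / n : ℝ) := by simp
    _ ≤ 4 * (12 * d / n : ℝ) := by
        have := badSupp_card e
        gcongr
        exact_mod_cast this
    _ ≤ 1 / 4 := by
        rw [← mul_div_assoc, div_le_iff₀ hn']
        linarith

def SimpleM {n d : ℕ} (f : PMatching n d) : Prop := ∀ e, ¬ badEv e f

open Finset in
lemma sparse_bound {n d : ℕ} (hd : 0 < d) (hnd : 192 * d ≤ n) :
    Real.exp (-(16 * (d:ℝ) ^ 2)) * (Nat.card (PMatching n d) : ℝ) ≤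
      Nat.card {f : PMatching n d // SimpleM f} := by
  classical
  have hn : 0 < n := by omega
  have hn' : (0:ℝ) < n := by exact_mod_cast hn
  have hd' : (1:ℝ) ≤ d := by exact_mod_cast hd
  have hm : 192 ≤ n * d := by nlinarith
  have hmR : (192:ℝ) ≤ (n:ℝ) * d := by exact_mod_cast hm
  have h := lll_main (badEv (n := n) (d := d)) (fun e g => ¬ Disjoint (badSupp e) (badSupp g)) badP
    badP_nonneg (by
      intro e
      rcases e with e | e <;> simp only [badP]
      · rw [div_le_iff₀ (by linarith)]; linarith
      · rw [div_le_iff₀ (by positivity)]; nlinarith)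
    (fun e S hS => neg_dep (by omega) e S hS) (fun e => nbr_sum hd hnd e)
  rw [Nat.card_eq_fintype_card]
  refine le_trans ?_ h
  have hs : ∑ e : BadIx n d, badP e ≤ 4 * (d:ℝ) ^ 2 := by
    rw [Fintype.sum_sum_type]
    have e1 : ∑ g : Fin n × Fin d × Fin d, badP (.inl g : BadIx n d) = 2 * d := by
      simp [badP]; field_simp
    have e2 : ∑ g : Fin n × Fin n × Fin d × Fin d × Fin d × Fin d, badP (.inr g : BadIx n d) = 2 * (d:ℝ) ^ 2 := by
      simp [badP]; field_simp
    rw [e1, e2]; nlinarith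
  refine mul_le_mul_of_nonneg_right (Real.exp_le_exp.2 ?_) (Nat.cast_nonneg _)
  linarith

def GraphIs {n d : ℕ} (g : RegGraph n d) (f : PMatching n d) : Prop :=
  ∀ u v, g.1 u v = true ↔ metaAdj f u v

lemma SimpleM.ne {n d : ℕ} {f : PMatching n d} (hf : SimpleM f) (v : Fin n) (j : Fin d) :
    (f.1 (v, j)).1 ≠ v := by
  intro h
  exact hf (.inl (v, j, (f.1 (v, j)).2)) (Prod.ext h rfl)

lemma SimpleM.inj {n d : ℕ} {f : PMatching n d} (hf : SimpleM f) (v : Fin n) :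
    Function.Injective fun j => (f.1 (v, j)).1 := by
  intro a a' h
  by_contra hne
  exact hf (.inr (v, (f.1 (v, a)).1, a, (f.1 (v, a)).2, a', (f.1 (v, a')).2))
    ⟨(hf.ne v a).symm, hne, rfl, Prod.ext h.symm rfl⟩

lemma simple_of {n d : ℕ} {f : PMatching n d} (h1 : ∀ v j, (f.1 (v, j)).1 ≠ v)
    (h2 : ∀ v, Function.Injective fun j => (f.1 (v, j)).1) : SimpleM f := by
  rintro (⟨i, a, b⟩ | ⟨i, j, a, b, a', b'⟩) h
  · exact h1 i a (congrArg Prod.fst h)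
  · obtain ⟨_, h3, h4, h5⟩ := h
    apply h3
    apply h2 i
    simp only [h4, h5]

lemma metaAdj_symm {n d : ℕ} {f : PMatching n d} {u v : Fin n} (h : metaAdj f u v) : metaAdj f v u := by
  obtain ⟨j, rfl⟩ := h
  exact ⟨(f.1 (u, j)).2, by rw [Prod.mk.eta, f.2.1]⟩

lemma exists_graph {n d : ℕ} {f : PMatching n d} (hf : SimpleM f) : ∃ g, GraphIs g f := by
  classical
  refine ⟨⟨fun u v => decide (metaAdj f u v), ?_, ?_, ?_⟩, ?_⟩
  · intro u v
    rw [decide_eq_decide]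
    exact ⟨metaAdj_symm, metaAdj_symm⟩
  · intro v
    rw [decide_eq_false_iff_not]
    rintro ⟨j, hj⟩
    exact hf.ne v j hj
  · intro v
    have : (Finset.univ.filter fun u => decide (metaAdj f v u) = true) =
        Finset.univ.image fun j => (f.1 (v, j)).1 := by
      ext u
      rw [Finset.mem_filter, Finset.mem_image, decide_eq_true_iff]
      simp [metaAdj]
    rw [this, Finset.card_image_of_injective _ (hf.inj v)]
    simp
  · intro u v
    simp

def mkM {n d : ℕ} (g : RegGraph n d) (s : ∀ v, Fin d ≃ {u // g.1 v u = true}) : PMatching n d :=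
  ⟨fun x => ((s x.1 x.2).1, (s (s x.1 x.2).1).symm ⟨x.1, (g.2.1 _ _).trans (s x.1 x.2).2⟩), by
    rintro ⟨v, j⟩
    have aux : ∀ w (_ : w = v) (h : g.1 w (s v j).1 = true), (s w).symm ⟨(s v j).1, h⟩ = j := by
      rintro w rfl h
      rw [Equiv.symm_apply_eq]
    refine Prod.ext (by simp) ?_
    exact aux _ (by simp) _, by
    rintro ⟨v, j⟩ h
    have h1 := congrArg Prod.fst h
    have h2 := (s v j).2
    simp only at h1
    rw [h1, g.2.2.1 v] at h2
    exact absurd h2 (by simp)⟩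

lemma card_fiber {n d : ℕ} (g : RegGraph n d) :
    Nat.card {f : PMatching n d // SimpleM f ∧ GraphIs g f} = (d.factorial) ^ n := by
  classical
  let Φ : (∀ v, Fin d ≃ {u // g.1 v u = true}) → {f : PMatching n d // SimpleM f ∧ GraphIs g f} :=
    fun s => ⟨mkM g s, by
      refine ⟨simple_of ?_ ?_, ?_⟩
      · intro v j h
        have h2 := (s v j).2
        change (s v j).1 = v at h
        rw [h, g.2.2.1 v] at h2
        exact absurd h2 (by simp)
      · intro v a b h
        exact (s v).injective (Subtype.ext h)
      · intro u v
        constructor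
        · intro h
          exact ⟨(s u).symm ⟨v, h⟩, by simp [mkM]⟩
        · rintro ⟨j, rfl⟩
          exact (s u j).2⟩
  have hΦ : Function.Bijective Φ := by
    constructor
    · intro s t h
      funext v
      ext j
      have h1 : mkM g s = mkM g t := congrArg Subtype.val h
      have h2 : ((mkM g s).1 (v, j)).1 = ((mkM g t).1 (v, j)).1 := by rw [h1]
      exact congrArg Fin.val h2
    · rintro ⟨f, hf, hg⟩
      let s : ∀ v, Fin d ≃ {u // g.1 v u = true} := fun v =>
        Equiv.ofBijective (fun j => ⟨(f.1 (v, j)).1, (hg _ _).2 ⟨j, rfl⟩⟩) (by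
          constructor
          · intro a b h
            exact hf.inj v (congrArg Subtype.val h)
          · rintro ⟨u, hu⟩
            obtain ⟨j, hj⟩ := (hg _ _).1 hu
            exact ⟨j, Subtype.ext hj⟩)
      refine ⟨s, ?_⟩
      apply Subtype.ext
      apply Subtype.ext
      funext x
      obtain ⟨v, j⟩ := x
      have hs : ∀ v j, (s v j).1 = (f.1 (v, j)).1 := fun _ _ => rfl
      refine Prod.ext rfl ?_
      change (s (s v j).1).symm ⟨v, _⟩ = (f.1 (v, j)).2
      rw [Equiv.symm_apply_eq]
      apply Subtype.ext
      change v = (f.1 ((f.1 (v, j)).1, (f.1 (v, j)).2)).1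
      rw [Prod.mk.eta, f.2.1]
  rw [← Nat.card_congr (Equiv.ofBijective Φ hΦ), Nat.card_pi]
  have : ∀ v, Nat.card (Fin d ≃ {u // g.1 v u = true}) = d.factorial := by
    intro v
    have hc : Fintype.card {u // g.1 v u = true} = d := by
      rw [Fintype.card_subtype]; exact g.2.2.2 v
    have e : Fin d ≃ {u // g.1 v u = true} := (Fintype.equivFinOfCardEq hc).symm
    rw [Nat.card_eq_fintype_card, Fintype.card_equiv e, Fintype.card_fin]
  rw [Finset.prod_congr rfl (fun v _ => this v)]
  simp

lemma card_lift {n d : ℕ} (E : RegGraph n d → Prop) :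
    cnt (fun f : PMatching n d => ∃ g, E g ∧ SimpleM f ∧ GraphIs g f) =
      Nat.card {g : RegGraph n d // E g} * (d.factorial) ^ n := by
  classical
  let Φ : (Σ g : {g : RegGraph n d // E g}, {f : PMatching n d // SimpleM f ∧ GraphIs g.1 f}) →
      {f : PMatching n d // ∃ g, E g ∧ SimpleM f ∧ GraphIs g f} :=
    fun p => ⟨p.2.1, p.1.1, p.1.2, p.2.2⟩
  have hΦ : Function.Bijective Φ := by
    constructor
    · rintro ⟨⟨g, hg⟩, ⟨f, hf⟩⟩ ⟨⟨g', hg'⟩, ⟨f', hf'⟩⟩ h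
      have h1 : f = f' := congrArg Subtype.val h
      subst h1
      have : g = g' := by
        apply Subtype.ext
        funext u v
        rw [Bool.eq_iff_iff]
        exact (hf.2 u v).trans (hf'.2 u v).symm
      subst this
      rfl
    · rintro ⟨f, g, hE, hf⟩
      exact ⟨⟨⟨g, hE⟩, ⟨f, hf⟩⟩, rfl⟩
  rw [cnt, ← Nat.card_congr (Equiv.ofBijective Φ hΦ), Nat.card_sigma]
  rw [Finset.sum_congr rfl (fun g _ => card_fiber g.1), Finset.sum_const, smul_eq_mul,
    Nat.card_eq_fintype_card, Finset.card_univ]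

lemma card_simple {n d : ℕ} :
    Nat.card {f : PMatching n d // SimpleM f} = Nat.card (RegGraph n d) * (d.factorial) ^ n := by
  have h := card_lift (n := n) (d := d) (fun _ => True)
  have h2 : Nat.card {g : RegGraph n d // True} = Nat.card (RegGraph n d) :=
    Nat.card_congr (Equiv.subtypeUnivEquiv (fun _ => trivial))
  rw [h2] at h
  rw [← h, cnt]
  apply Nat.card_congr
  apply Equiv.subtypeEquivRight
  intro f
  constructor
  · intro hf
    obtain ⟨g, hg⟩ := exists_graph hf
    exact ⟨g, trivial, hf, hg⟩
  · rintro ⟨g, _, hf, _⟩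
    exact hf

lemma card_PM_le {n d k : ℕ} (hk : n * d = 2 * k) : Nat.card (PMatching n d) ≤ k ^ k := by
  classical
  have h1 : Nat.card (PMatching n d) ≤
      (Finset.univ.filter fun g : Equiv.Perm (Fin n × Fin d) => g.cycleType = Multiset.replicate k 2).card := by
    rw [← Fintype.card_subtype, ← Nat.card_eq_fintype_card]
    refine Nat.card_le_card_of_injective (fun f : PMatching n d => ⟨f.2.1.toPerm, ?_⟩) ?_
    · have hp : f.2.1.toPerm ^ 2 = 1 := by
        ext x : 1
        simp [pow_two, f.2.1 x]
      have h2 := Equiv.Perm.pow_prime_eq_one_iff.1 hp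
      have h3 := Multiset.eq_replicate_card.2 h2
      have h4 := f.2.1.toPerm.sum_cycleType
      have h5 : f.2.1.toPerm.support = Finset.univ := by
        ext x; simp [f.2.2 x]
      rw [h5, Finset.card_univ, Fintype.card_prod, Fintype.card_fin, Fintype.card_fin, hk, h3,
        Multiset.sum_replicate, smul_eq_mul] at h4
      rw [h3]
      congr 1
      omega
    · intro f f' h
      have := congrArg (fun t => (t.1 : Fin n × Fin d → Fin n × Fin d)) h
      exact Subtype.ext this
  have h2 := Equiv.Perm.card_of_cycleType_mul_eq (Fin n × Fin d) (Multiset.replicate k 2)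
  rw [Fintype.card_prod, Fintype.card_fin, Fintype.card_fin, hk] at h2
  refine h1.trans ?_
  set c := (Finset.univ.filter fun g : Equiv.Perm (Fin n × Fin d) => g.cycleType = Multiset.replicate k 2).card
  rcases Nat.eq_zero_or_pos k with rfl | hkpos
  · simp at h2; simp [h2]
  have h3 : c * (2 ^ k * k.factorial) = (2 * k).factorial := by
    have e1 : (Multiset.replicate k 2).toFinset = {2} := Multiset.toFinset_replicate k 2 |>.trans (by simp [hkpos.ne'])
    rw [e1] at h2
    simp [Multiset.sum_replicate, mul_comm k 2] at h2
    rw [h2, if_pos]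
    intro a ha
    exact (Multiset.eq_of_mem_replicate ha).ge
  have h4 : (2 * k).factorial ≤ k.factorial * (2 * k) ^ k := by
    have := Nat.ascFactorial_le_pow_add k k
    rw [two_mul, ← Nat.factorial_mul_ascFactorial]
    gcongr
  have h5 : (2 ^ k * k.factorial) * c ≤ (2 ^ k * k.factorial) * k ^ k := by
    calc _ = c * (2 ^ k * k.factorial) := mul_comm _ _
      _ ≤ _ := h3.le.trans h4
      _ = _ := by rw [mul_pow]; ring
  exact Nat.le_of_mul_le_mul_left h5 (by positivity)

lemma dense_bound {n d : ℕ} (hd : 0 < d) (hnd : n ≤ 192 * d) (he : Even (n * d)) :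
    Real.exp (-(1000 * (d:ℝ) ^ 2)) * (Nat.card (PMatching n d) : ℝ) ≤ ((d.factorial ^ n : ℕ) : ℝ) := by
  obtain ⟨k, hk⟩ := he
  have hk2 : n * d = 2 * k := by omega
  have h1 : (Nat.card (PMatching n d) : ℝ) ≤ (k:ℝ) ^ k := by exact_mod_cast card_PM_le hk2
  have hd' : (0:ℝ) < d := by exact_mod_cast hd
  have h2 : (d:ℝ) ^ d / d.factorial ≤ Real.exp d := Real.pow_div_factorial_le_exp _ hd'.le _
  rw [div_le_iff₀ (by positivity)] at h2
  have hkR : (n:ℝ) * d = 2 * k := by exact_mod_cast hk2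
  have hndR : (n:ℝ) ≤ 192 * d := by exact_mod_cast hnd
  have hk3 : (k:ℝ) ≤ 96 * d ^ 2 := by nlinarith
  have h3 : ((d:ℝ) ^ 2) ^ k ≤ Real.exp (2 * k) * ((d.factorial ^ n : ℕ) : ℝ) := by
    have := pow_le_pow_left₀ (by positivity) h2 n
    rw [← pow_mul, mul_comm d n, hk2, pow_mul, mul_pow, ← Real.exp_nat_mul, hkR] at this
    push_cast
    exact this
  have h96 : (96:ℝ) ≤ Real.exp 5 := by
    have h := Real.exp_one_gt_d9
    have e5 : Real.exp 5 = Real.exp 1 ^ 5 := by rw [← Real.exp_nat_mul]; norm_num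
    rw [e5]
    calc (96:ℝ) ≤ 2.7 ^ 5 := by norm_num
      _ ≤ _ := by gcongr; linarith
  have h4 : (k:ℝ) ^ k ≤ Real.exp (5 * k) * ((d:ℝ) ^ 2) ^ k := by
    calc (k:ℝ) ^ k ≤ (96 * (d:ℝ) ^ 2) ^ k := by gcongr
      _ = 96 ^ k * ((d:ℝ) ^ 2) ^ k := mul_pow _ _ _
      _ ≤ (Real.exp 5) ^ k * ((d:ℝ) ^ 2) ^ k := by gcongr
      _ = _ := by rw [← Real.exp_nat_mul, mul_comm (k:ℝ) 5]
  set F : ℝ := ((d.factorial ^ n : ℕ) : ℝ)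
  have hF : 0 ≤ F := Nat.cast_nonneg _
  calc _ ≤ Real.exp (-(1000 * (d:ℝ) ^ 2)) * (Real.exp (5 * k) * (Real.exp (2 * k) * F)) := by
        gcongr
        exact h1.trans (h4.trans (by gcongr))
    _ = Real.exp (-(1000 * (d:ℝ) ^ 2) + 5 * k + 2 * k) * F := by
        rw [Real.exp_add, Real.exp_add]; ring
    _ ≤ 1 * F := by
        gcongr
        rw [Real.exp_le_one_iff]
        nlinarith
    _ = F := one_mul _

lemma key_bound {n d : ℕ} (hd : 0 < d) (he : Even (n * d)) (hN : 0 < Nat.card (RegGraph n d)) :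
    Real.exp (-(1000 * (d:ℝ) ^ 2)) * (Nat.card (PMatching n d) : ℝ) ≤
      (Nat.card (RegGraph n d) : ℝ) * ((d.factorial ^ n : ℕ) : ℝ) := by
  rcases le_total (192 * d) n with h | h
  · have h1 := sparse_bound hd h
    rw [card_simple] at h1
    push_cast at h1 ⊢
    refine le_trans ?_ h1
    gcongr
    norm_num
  · refine (dense_bound hd h he).trans ?_
    have : (1:ℝ) ≤ Nat.card (RegGraph n d) := by exact_mod_cast hN
    nlinarith [Nat.cast_nonneg (α := ℝ) (d.factorial ^ n)]

def trMap {n d : ℕ} (e : Fin n × (Fin d → Fin n × Fin d)) : Fin n × Finset (Fin n) :=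
  (e.1, Finset.univ.image fun j => (e.2 j).1)

def toM {n : ℕ} (d : ℕ) (A : NAlgo n) : MAlgo n d where
  nextQuery h := A.nextQuery (h.map trMap)
  output h := A.output (h.map trMap)

lemma run_eq {n d : ℕ} (A : NAlgo n) (g : RegGraph n d) (f : PMatching n d) (hg : GraphIs g f) (q : ℕ) :
    (mRun (toM d A) f q).map trMap = nRun A g q := by
  induction q with
  | zero => rfl
  | succ q ih =>
    simp only [mRun, nRun, List.map_append, List.map_cons, List.map_nil, ih]
    have e : (toM d A).nextQuery (mRun (toM d A) f q) = A.nextQuery (nRun A g q) := by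
      rw [← ih]; rfl
    rw [e]
    congr 2
    refine Prod.ext rfl ?_
    ext u
    simp only [trMap, Finset.mem_image, Finset.mem_univ, true_and, Finset.mem_filter]
    exact (hg _ u).symm

lemma det_bound {n d q : ℕ} (hd : 0 < d) (he : Even (n * d)) (A : NAlgo n) (s t : Fin n) :
    Real.exp (-(1000 * (d:ℝ) ^ 2)) *
      regProb n d (fun g => IsValidPathReg g s t (A.output (nRun A g q))) ≤
    mProb n d (fun f => IsValidMeta f s t ((toM d A).output (mRun (toM d A) f q))) := by
  unfold regProb mProb
  set E : RegGraph n d → Prop := fun g => IsValidPathReg g s t (A.output (nRun A g q)) with hE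
  rcases Nat.eq_zero_or_pos (Nat.card (RegGraph n d)) with h0 | hN
  · rw [h0]; simp; positivity
  have hkey := key_bound hd he hN
  have hle : Nat.card (RegGraph n d) * d.factorial ^ n ≤ Nat.card (PMatching n d) := by
    rw [← card_simple]
    exact Nat.card_le_card_of_injective _ Subtype.val_injective
  have hM : 0 < Nat.card (PMatching n d) := lt_of_lt_of_le (by positivity) hle
  have hs : Nat.card {g : RegGraph n d // E g} * d.factorial ^ n ≤
      Nat.card {f : PMatching n d // IsValidMeta f s t ((toM d A).output (mRun (toM d A) f q))} := by
    rw [← card_lift]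
    refine cnt_mono ?_
    rintro f ⟨g, hEg, hf, hg⟩
    have hr := run_eq A g f hg q
    have ho : (toM d A).output (mRun (toM d A) f q) = A.output (nRun A g q) := by rw [← hr]; rfl
    rw [ho]
    refine ⟨hEg.1, hEg.2.1, ?_⟩
    exact List.IsChain.imp (fun a b h => (hg a b).1 h) hEg.2.2
  have hNR : (0:ℝ) < Nat.card (RegGraph n d) := by exact_mod_cast hN
  have hMR : (0:ℝ) < Nat.card (PMatching n d) := by exact_mod_cast hM
  have hsR : (Nat.card {g : RegGraph n d // E g} : ℝ) * ((d.factorial ^ n : ℕ) : ℝ) ≤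
      Nat.card {f : PMatching n d // IsValidMeta f s t ((toM d A).output (mRun (toM d A) f q))} := by
    exact_mod_cast hs
  rw [← mul_div_assoc, div_le_div_iff₀ hNR hMR]
  have hc : (0:ℝ) ≤ Nat.card {g : RegGraph n d // E g} := Nat.cast_nonneg _
  calc _ = (Nat.card {g : RegGraph n d // E g} : ℝ) *
        (Real.exp (-(1000 * (d:ℝ) ^ 2)) * (Nat.card (PMatching n d) : ℝ)) := by ring
    _ ≤ (Nat.card {g : RegGraph n d // E g} : ℝ) *
        ((Nat.card (RegGraph n d) : ℝ) * ((d.factorial ^ n : ℕ) : ℝ)) := by gcongr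
    _ = (Nat.card {g : RegGraph n d // E g} : ℝ) * ((d.factorial ^ n : ℕ) : ℝ) * (Nat.card (RegGraph n d) : ℝ) := by ring
    _ ≤ _ := by gcongr

/-- Reduction from `d`-regular graphs to matchings.  There is an absolute constant `C > 0`
(so `c(d) := exp(−C·d²)` is `exp(−O(d²))`) such that: if a possibly randomized algorithm
(modeled by a finite randomness source `Ω` with weights `ρ` and a deterministic algorithm
`Alg r` for each seed `r`) makes at most `q` node-incidence queries on a uniformly random
simple `d`-regular graph on `n` vertices and reports a valid `s`-`t` path (`s = 1`, i.e.
vertex `0` of `Fin n`, `t = n`, i.e. vertex `n−1`) with probability `α`, then some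
deterministic algorithm making at most `q` group-incidence queries on a uniformly random
perfect matching from `M_{n,d}` reports a valid `s`-`t` meta-path with probability at
least `exp(−C·d²)·α`. -/
theorem stmt11 : ∃ C : ℝ, 0 < C ∧
    ∀ (n d q : ℕ) (hn : 2 ≤ n) (hd : 0 < d) (hdn : d < n) (heven : Even (n * d))
      (Ω : Type) (_ : Fintype Ω) (ρ : Ω → ℝ) (hρ : ∀ r, 0 ≤ ρ r) (hsum : ∑ r, ρ r = 1)
      (Alg : Ω → NAlgo n) (α : ℝ),
      α = ∑ r, ρ r * regProb n d (fun g =>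
            IsValidPathReg g ⟨0, by omega⟩ ⟨n - 1, by omega⟩
              ((Alg r).output (nRun (Alg r) g q))) →
      ∃ B : MAlgo n d,
        Real.exp (-(C * (d : ℝ) ^ 2)) * α ≤
          mProb n d (fun f =>
            IsValidMeta f ⟨0, by omega⟩ ⟨n - 1, by omega⟩ (B.output (mRun B f q))) := by
  refine ⟨1000, by norm_num, ?_⟩
  intro n d q hn hd hdn heven Ω _ ρ hρ hsum Alg α hα
  have hex : ∃ r, α ≤ regProb n d (fun g =>
      IsValidPathReg g ⟨0, by omega⟩ ⟨n - 1, by omega⟩ ((Alg r).output (nRun (Alg r) g q))) := by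
    by_contra hcon
    push Not at hcon
    have hne : ∃ r, 0 < ρ r := by
      by_contra h
      push Not at h
      have : ∑ r, ρ r ≤ 0 := Finset.sum_nonpos fun r _ => h r
      linarith
    obtain ⟨r0, hr0⟩ := hne
    have hlt : α < ∑ r, ρ r * α := by
      conv_lhs => rw [hα]
      exact Finset.sum_lt_sum (fun r _ => mul_le_mul_of_nonneg_left (hcon r).le (hρ r))
        ⟨r0, Finset.mem_univ _, mul_lt_mul_of_pos_left (hcon r0) hr0⟩
    rw [← Finset.sum_mul, hsum, one_mul] at hlt
    exact lt_irrefl _ hlt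
  obtain ⟨r, hr⟩ := hex
  refine ⟨toM d (Alg r), le_trans ?_ (det_bound hd heven (Alg r) _ _)⟩
  exact mul_le_mul_of_nonneg_left hr (Real.exp_pos _).le
end

section
/- Let n, d be positive integers with nd even, and let G be a uniformly random perfect matching drawn from M_{n,d}. Let q satisfy 2dq < nd − 1. Then every deterministic adaptive algorithm making at most q group-incidence queries and then outputting a meta-path from s = 1 to t = n outputs a valid meta-path with probability at most d²/(nd − 1 − 2dq) + d³q²/(nd − 1 − 2dq). -/
/-- vertex already matched in the transcript -/
def seenV {n d : ℕ} (h : List (Fin n × (Fin d → Fin n × Fin d))) (v : Fin n × Fin d) : Prop :=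
  ∃ e ∈ h, e.1 = v.1 ∨ ∃ j, e.2 j = v

/-- conjugate a matching by a swap -/
def conjM {n d : ℕ} (y z : Fin n × Fin d) (f : PMatching n d) : PMatching n d :=
  ⟨fun v => Equiv.swap y z (f.1 (Equiv.swap y z v)), by
    intro v
    simp [f.2.1 (Equiv.swap y z v)], by
    intro v hv
    apply f.2.2 (Equiv.swap y z v)
    apply (Equiv.swap y z).injective
    simpa using hv⟩

lemma conjM_inj {n d : ℕ} (y z : Fin n × Fin d) : Function.Injective (conjM (n := n) y z) := by
  intro f g h
  apply Subtype.ext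
  funext v
  have := congrFun (congrArg Subtype.val h) (Equiv.swap y z v)
  simpa [conjM] using this

lemma seenV_mono {n d : ℕ} {h h' : List (Fin n × (Fin d → Fin n × Fin d))} {v : Fin n × Fin d}
    (hs : seenV h v) : seenV (h ++ h') v := by
  obtain ⟨e, he, h1⟩ := hs
  exact ⟨e, by simp [he], h1⟩

lemma mRun_conj {n d : ℕ} (A : MAlgo n d) (f : PMatching n d) (y z : Fin n × Fin d) (k : ℕ)
    (hy : ¬ seenV (mRun A f k) y) (hz : ¬ seenV (mRun A f k) z) :
    mRun A (conjM y z f) k = mRun A f k := by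
  induction k with
  | zero => rfl
  | succ k ih =>
    have ih' := ih (fun h => hy (seenV_mono h)) (fun h => hz (seenV_mono h))
    simp only [mRun] at hy hz ⊢
    rw [ih']
    congr 4
    funext j
    have key : ∀ w, ¬ seenV (mRun A f k ++ [(A.nextQuery (mRun A f k),
        fun j => f.1 (A.nextQuery (mRun A f k), j))]) w →
        (A.nextQuery (mRun A f k), j) ≠ w ∧ f.1 (A.nextQuery (mRun A f k), j) ≠ w := by
      intro w hw
      constructor
      · intro h
        exact hw ⟨_, List.mem_append_right _ (List.mem_singleton_self _), Or.inl (by rw [← h])⟩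
      · intro h
        exact hw ⟨_, List.mem_append_right _ (List.mem_singleton_self _), Or.inr ⟨j, h⟩⟩
    have ky := key y hy
    have kz := key z hz
    simp only [conjM]
    rw [Equiv.swap_apply_of_ne_of_ne ky.1 kz.1, Equiv.swap_apply_of_ne_of_ne ky.2 kz.2]

lemma mRun_length {n d : ℕ} (A : MAlgo n d) (f : PMatching n d) (k : ℕ) :
    (mRun A f k).length = k := by
  induction k with
  | zero => rfl
  | succ k ih => simp [mRun, ih]

lemma mRun_spec {n d : ℕ} (A : MAlgo n d) (f : PMatching n d) (k : ℕ) :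
    ∀ e ∈ mRun A f k, ∀ j, e.2 j = f.1 (e.1, j) := by
  induction k with
  | zero => simp [mRun]
  | succ k ih =>
    intro e he j
    simp only [mRun, List.mem_append, List.mem_singleton] at he
    rcases he with he | he
    · exact ih e he j
    · subst he; rfl

lemma seenV_disc {n d : ℕ} (A : MAlgo n d) (f : PMatching n d) (k : ℕ) (a : Fin n) (j : Fin d)
    (hs : seenV (mRun A f k) (a, j)) : discMetaAdj (mRun A f k) a (f.1 (a, j)).1 := by
  obtain ⟨e, he, h | ⟨j', h⟩⟩ := hs
  · refine ⟨e, he, j, Or.inl ⟨h, ?_⟩⟩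
    rw [mRun_spec A f k e he j]
    simp only at h
    rw [h]
  · refine ⟨e, he, j', Or.inr ⟨?_, by rw [h]⟩⟩
    rw [mRun_spec A f k e he j'] at h
    rw [← h, f.2.1]

lemma seenV_image {n d : ℕ} (A : MAlgo n d) (f : PMatching n d) (k : ℕ) (v : Fin n × Fin d)
    (hs : seenV (mRun A f k) (f.1 v)) : seenV (mRun A f k) v := by
  obtain ⟨e, he, h | ⟨j', h⟩⟩ := hs
  · refine ⟨e, he, Or.inr ⟨(f.1 v).2, ?_⟩⟩
    rw [mRun_spec A f k e he, h]
    exact f.2.1 v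
  · refine ⟨e, he, Or.inl ?_⟩
    rw [mRun_spec A f k e he] at h
    have := f.2.1.injective h
    rw [← this]

open Classical in
lemma card_seen {n d : ℕ} (h : List (Fin n × (Fin d → Fin n × Fin d))) :
    (Finset.univ.filter (fun v => seenV h v)).card ≤ 2 * d * h.length := by
  have hsub : Finset.univ.filter (fun v => seenV h v) ⊆
      h.toFinset.biUnion (fun e => (Finset.univ.image (fun j : Fin d => (e.1, j))) ∪
        Finset.univ.image e.2) := by
    intro v hv
    obtain ⟨e, he, h1⟩ := (Finset.mem_filter.1 hv).2
    simp only [Finset.mem_biUnion, List.mem_toFinset, Finset.mem_union, Finset.mem_image,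
      Finset.mem_univ, true_and]
    refine ⟨e, he, ?_⟩
    rcases h1 with h1 | h1
    · exact Or.inl ⟨v.2, by rw [h1]⟩
    · exact Or.inr h1
  refine (Finset.card_le_card hsub).trans ?_
  refine (Finset.card_biUnion_le_card_mul _ _ (2 * d) ?_).trans ?_
  · intro e _
    refine (Finset.card_union_le _ _).trans ?_
    have h1 := Finset.card_image_le (s := (Finset.univ : Finset (Fin d))) (f := fun j => (e.1, j))
    have h2 := Finset.card_image_le (s := (Finset.univ : Finset (Fin d))) (f := e.2)
    simp only [Finset.card_univ, Fintype.card_fin] at h1 h2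
    omega
  · rw [mul_comm]
    exact Nat.mul_le_mul_left _ (List.toFinset_card_le h)

open Classical in
lemma fiber_bound {n d : ℕ} (A : MAlgo n d) (k : ℕ) (h : List (Fin n × (Fin d → Fin n × Fin d)))
    (x y : Fin n × Fin d) (hy : ¬ seenV h y) (hlen : h.length = k) :
    ((n : ℝ) * d - 1 - 2 * d * k) *
      ((Finset.univ.filter (fun f : PMatching n d => mRun A f k = h ∧ f.1 x = y)).card : ℝ)
      ≤ ((Finset.univ.filter (fun f : PMatching n d => mRun A f k = h)).card : ℝ) := by
  by_cases hxy : x = y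
  · have : (Finset.univ.filter (fun f : PMatching n d => mRun A f k = h ∧ f.1 x = y)) = ∅ := by
      ext f
      simp only [Finset.mem_filter, Finset.mem_univ, true_and, Finset.notMem_empty, iff_false]
      rintro ⟨_, h2⟩
      exact f.2.2 x (h2.trans hxy.symm)
    rw [this]; simp
  set U := (Finset.univ.filter (fun v => ¬ seenV h v)).erase x with hU
  have hUc : (n : ℝ) * d - 1 - 2 * d * k ≤ U.card := by
    have h1 := Finset.card_filter_add_card_filter_not (s := (Finset.univ : Finset (Fin n × Fin d)))
      (fun v => seenV h v)
    have h2 := card_seen h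
    have h3 := Finset.pred_card_le_card_erase (s := Finset.univ.filter (fun v => ¬ seenV h v))
      (a := x)
    simp only [Finset.card_univ, Fintype.card_prod, Fintype.card_fin] at h1
    rw [← hU] at h3
    rw [hlen] at h2
    have h4 : n * d ≤ U.card + 1 + 2 * d * k := by omega
    have h5 : (n : ℝ) * d ≤ U.card + 1 + 2 * d * k := by exact_mod_cast h4
    linarith
  have h1 : U.card * (Finset.univ.filter
      (fun f : PMatching n d => mRun A f k = h ∧ f.1 x = y)).card ≤
      (Finset.univ.filter (fun f : PMatching n d => mRun A f k = h)).card := by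
    calc _ = ∑ z ∈ U, (Finset.univ.filter
      (fun f : PMatching n d => mRun A f k = h ∧ f.1 x = y)).card := by simp
      _ ≤ ∑ z ∈ U, (Finset.univ.filter
      (fun f : PMatching n d => mRun A f k = h ∧ f.1 x = z)).card := by
        apply Finset.sum_le_sum
        intro z hz
        have hzx : z ≠ x := (Finset.mem_erase.1 hz).1
        have hzs : ¬ seenV h z := (Finset.mem_filter.1 (Finset.mem_erase.1 hz).2).2
        apply Finset.card_le_card_of_injOn (conjM y z) _ (conjM_inj y z).injOn
        intro f hf
        have hf' := (Finset.mem_filter.1 (Finset.mem_coe.1 hf)).2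
        apply Finset.mem_coe.2
        refine Finset.mem_filter.2 ⟨Finset.mem_univ _, ?_, ?_⟩
        · rw [mRun_conj A f y z k (by rw [hf'.1]; exact hy) (by rw [hf'.1]; exact hzs), hf'.1]
        · simp only [conjM]
          rw [Equiv.swap_apply_of_ne_of_ne hxy hzx.symm, hf'.2, Equiv.swap_apply_left]
      _ = (U.biUnion (fun z => Finset.univ.filter
      (fun f : PMatching n d => mRun A f k = h ∧ f.1 x = z))).card := by
        rw [Finset.card_biUnion]
        intro z _ w _ hzw
        rw [Function.onFun, Finset.disjoint_left]
        intro f hf hf'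
        exact hzw ((Finset.mem_filter.1 hf).2.2.symm.trans (Finset.mem_filter.1 hf').2.2)
      _ ≤ _ := by
        apply Finset.card_le_card
        intro f hf
        obtain ⟨z, _, hz⟩ := Finset.mem_biUnion.1 hf
        exact Finset.mem_filter.2 ⟨Finset.mem_univ _, (Finset.mem_filter.1 hz).2.1⟩
  refine le_trans (mul_le_mul_of_nonneg_right hUc (Nat.cast_nonneg _)) ?_
  exact_mod_cast h1

open Classical in
lemma event_bound {n d : ℕ} (A : MAlgo n d) (k c : ℕ) (E : PMatching n d → Prop) [DecidablePred E]
    (hD : 0 ≤ (n : ℝ) * d - 1 - 2 * d * k)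
    (hE : ∀ f0 : PMatching n d, ∃ (a : Fin n) (T : Finset (Fin n)), T.card ≤ c ∧
      ∀ f : PMatching n d, mRun A f k = mRun A f0 k → E f →
        ∃ j, (f.1 (a, j)).1 ∈ T ∧ ¬ discMetaAdj (mRun A f k) a (f.1 (a, j)).1) :
    ((n : ℝ) * d - 1 - 2 * d * k) * ((Finset.univ.filter E).card : ℝ) ≤
      (d : ℝ) ^ 2 * c * (Fintype.card (PMatching n d) : ℝ) := by
  set D := (n : ℝ) * d - 1 - 2 * d * k with hDdef
  set I := (Finset.univ : Finset (PMatching n d)).image (fun f => mRun A f k) with hI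
  have e1 : (Finset.univ.filter E).card =
      ∑ h ∈ I, ((Finset.univ.filter E).filter (fun f => mRun A f k = h)).card :=
    Finset.card_eq_sum_card_fiberwise (by intro f _; simp [hI])
  have e2 : Fintype.card (PMatching n d) =
      ∑ h ∈ I, (Finset.univ.filter (fun f : PMatching n d => mRun A f k = h)).card := by
    rw [← Finset.card_univ]
    exact Finset.card_eq_sum_card_fiberwise (by intro f _; simp [hI])
  rw [e1, e2]
  push_cast
  rw [Finset.mul_sum, Finset.mul_sum]
  apply Finset.sum_le_sum
  intro h hh
  obtain ⟨f0, -, rfl⟩ := Finset.mem_image.1 hh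
  obtain ⟨a, T, hT, hf⟩ := hE f0
  set h := mRun A f0 k with hh0
  have hlen : h.length = k := mRun_length A f0 k
  set P : Finset (Fin d × (Fin n × Fin d)) :=
    (Finset.univ ×ˢ (T ×ˢ Finset.univ)).filter (fun p => ¬ seenV h p.2) with hP
  have hPc : P.card ≤ d ^ 2 * c := by
    refine (Finset.card_filter_le _ _).trans ?_
    simp only [Finset.card_product, Finset.card_univ, Fintype.card_fin]
    calc d * (T.card * d) ≤ d * (c * d) := by gcongr
      _ = _ := by ring
  have hsub : (Finset.univ.filter E).filter (fun f => mRun A f k = h) ⊆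
      P.biUnion (fun p => Finset.univ.filter
        (fun f : PMatching n d => mRun A f k = h ∧ f.1 (a, p.1) = p.2)) := by
    intro f hf'
    simp only [Finset.mem_filter, Finset.mem_univ, true_and] at hf'
    obtain ⟨j, hj1, hj2⟩ := hf f hf'.2 hf'.1
    refine Finset.mem_biUnion.2 ⟨(j, f.1 (a, j)), ?_, ?_⟩
    · simp only [hP, Finset.mem_filter, Finset.mem_product, Finset.mem_univ, true_and, and_true]
      refine ⟨hj1, fun hs => hj2 ?_⟩
      rw [← hf'.2] at hs
      exact seenV_disc A f k a j (seenV_image A f k _ hs)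
    · simp [hf'.2]
  have hle := (Finset.card_le_card hsub).trans Finset.card_biUnion_le
  have hle' : (((Finset.univ.filter E).filter (fun f => mRun A f k = h)).card : ℝ) ≤
      ∑ p ∈ P, ((Finset.univ.filter
        (fun f : PMatching n d => mRun A f k = h ∧ f.1 (a, p.1) = p.2)).card : ℝ) := by
    exact_mod_cast hle
  calc _ ≤ D * ∑ p ∈ P, ((Finset.univ.filter
        (fun f : PMatching n d => mRun A f k = h ∧ f.1 (a, p.1) = p.2)).card : ℝ) :=
        mul_le_mul_of_nonneg_left hle' hD
    _ = ∑ p ∈ P, D * ((Finset.univ.filter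
        (fun f : PMatching n d => mRun A f k = h ∧ f.1 (a, p.1) = p.2)).card : ℝ) :=
        Finset.mul_sum _ _ _
    _ ≤ ∑ p ∈ P, ((Finset.univ.filter (fun f : PMatching n d => mRun A f k = h)).card : ℝ) := by
        apply Finset.sum_le_sum
        intro p hp
        exact fiber_bound A k h (a, p.1) p.2 (Finset.mem_filter.1 hp).2 hlen
    _ = P.card * ((Finset.univ.filter (fun f : PMatching n d => mRun A f k = h)).card : ℝ) := by
        simp
    _ ≤ _ := by
        apply mul_le_mul_of_nonneg_right _ (Nat.cast_nonneg _)
        exact_mod_cast hPc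

/-- connected in the discovered graph -/
def connD {n d : ℕ} (h : List (Fin n × (Fin d → Fin n × Fin d))) (a b : Fin n) : Prop :=
  Relation.ReflTransGen (discMetaAdj h) a b

lemma discMetaAdj_symm {n d : ℕ} (h : List (Fin n × (Fin d → Fin n × Fin d))) :
    Symmetric (discMetaAdj h) := by
  rintro a b ⟨e, he, j, h1⟩
  exact ⟨e, he, j, h1.symm⟩

lemma connD_symm {n d : ℕ} {h : List (Fin n × (Fin d → Fin n × Fin d))} {a b : Fin n}
    (hab : connD h a b) : connD h b a := by
  unfold connD at *
  induction hab with
  | refl => exact .refl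
  | tail _ h2 ih => exact .head (discMetaAdj_symm h h2) ih

open Classical in
lemma card_comp {n d : ℕ} (h : List (Fin n × (Fin d → Fin n × Fin d))) (u : Fin n) :
    (Finset.univ.filter (fun g => connD h u g)).card ≤ 1 + h.length * (d + 1) := by
  have hsub : Finset.univ.filter (fun g => connD h u g) ⊆
      insert u (h.toFinset.biUnion (fun e => insert e.1 (Finset.univ.image (fun j => (e.2 j).1)))) := by
    intro g hg
    have hg := (Finset.mem_filter.1 hg).2
    rcases Relation.ReflTransGen.cases_tail hg with h1 | ⟨b, _, e, he, j, h1⟩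
    · simp [h1]
    · apply Finset.mem_insert_of_mem
      refine Finset.mem_biUnion.2 ⟨e, by simpa using he, ?_⟩
      rcases h1 with h1 | h1
      · apply Finset.mem_insert_of_mem
        exact Finset.mem_image.2 ⟨j, Finset.mem_univ _, h1.2⟩
      · rw [h1.1]; exact Finset.mem_insert_self _ _
  refine (Finset.card_le_card hsub).trans ((Finset.card_insert_le _ _).trans ?_)
  rw [add_comm]
  apply Nat.add_le_add_left
  refine (Finset.card_biUnion_le_card_mul _ _ (d + 1) ?_).trans ?_
  · intro e _
    refine (Finset.card_insert_le _ _).trans ?_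
    have h1 := Finset.card_image_le (s := (Finset.univ : Finset (Fin d))) (f := fun j => (e.2 j).1)
    simp only [Finset.card_univ, Fintype.card_fin] at h1
    omega
  · exact Nat.mul_le_mul_right _ (List.toFinset_card_le h)

lemma step_hit {n d : ℕ} (A : MAlgo n d) (f : PMatching n d) (k : ℕ) (u w : Fin n)
    (hi : ¬ connD (mRun A f k) u (A.nextQuery (mRun A f k)))
    (h1 : ¬ connD (mRun A f k) u w) (h2 : connD (mRun A f (k + 1)) u w) :
    ∃ j, connD (mRun A f k) u (f.1 (A.nextQuery (mRun A f k), j)).1 := by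
  by_contra hno
  push Not at hno
  apply h1
  clear h1
  unfold connD at h2
  induction h2 with
  | refl => exact .refl
  | @tail b c _ hbc ih =>
    obtain ⟨e, he, j, h3⟩ := hbc
    simp only [mRun, List.mem_append, List.mem_singleton] at he
    rcases he with he | rfl
    · exact Relation.ReflTransGen.tail ih ⟨e, he, j, h3⟩
    · exfalso
      rcases h3 with ⟨h3, _⟩ | ⟨_, h3⟩
      · exact hi (by simp only at h3; rw [h3]; exact ih)
      · exact hno j (by simp only at h3; rw [h3]; exact ih)

open Classical in
lemma step_bound {n d : ℕ} (A : MAlgo n d) (k : ℕ) (s t : Fin n)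
    (hD : 0 ≤ (n : ℝ) * d - 1 - 2 * d * k) :
    ((n : ℝ) * d - 1 - 2 * d * k) * ((Finset.univ.filter (fun f : PMatching n d =>
      ¬ connD (mRun A f k) s t ∧ connD (mRun A f (k + 1)) s t)).card : ℝ) ≤
      (d : ℝ) ^ 2 * ((1 + k * (d + 1) : ℕ) : ℝ) * (Fintype.card (PMatching n d) : ℝ) := by
  refine event_bound A k _ (fun f : PMatching n d =>
      ¬ connD (mRun A f k) s t ∧ connD (mRun A f (k + 1)) s t) hD ?_
  intro f0
  have main : ∀ u w : Fin n, ¬ connD (mRun A f0 k) u (A.nextQuery (mRun A f0 k)) →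
      ∃ (a : Fin n) (T : Finset (Fin n)), T.card ≤ 1 + k * (d + 1) ∧
      ∀ f : PMatching n d, mRun A f k = mRun A f0 k →
        (¬ connD (mRun A f k) u w ∧ connD (mRun A f (k + 1)) u w) →
        ∃ j, (f.1 (a, j)).1 ∈ T ∧ ¬ discMetaAdj (mRun A f k) a (f.1 (a, j)).1 := by
    intro u w hu
    refine ⟨A.nextQuery (mRun A f0 k), Finset.univ.filter (fun g => connD (mRun A f0 k) u g),
      ?_, ?_⟩
    · have := card_comp (mRun A f0 k) u
      rwa [mRun_length] at this
    · rintro f hf ⟨h1, h2⟩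
      obtain ⟨j, hj⟩ := step_hit A f k u w (by rw [hf]; exact hu) h1 h2
      rw [hf] at hj ⊢
      refine ⟨j, by simpa using hj, fun hdisc => hu ?_⟩
      exact Relation.ReflTransGen.tail hj (discMetaAdj_symm _ hdisc)
  by_cases hc : connD (mRun A f0 k) t (A.nextQuery (mRun A f0 k))
  · by_cases hs : connD (mRun A f0 k) s (A.nextQuery (mRun A f0 k))
    · refine ⟨s, ∅, by simp, ?_⟩
      rintro f hf ⟨h1, -⟩
      rw [hf] at h1
      exact absurd (Relation.ReflTransGen.trans hs (connD_symm hc)) h1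
    · exact main s t hs
  · obtain ⟨a, T, hT, hh⟩ := main t s hc
    exact ⟨a, T, hT, fun f hf h1 => hh f hf ⟨fun h => h1.1 (connD_symm h), connD_symm h1.2⟩⟩

lemma exists_hop {α : Type*} (C : α → Prop) (R : α → α → Prop) :
    ∀ (L : List α) (s t : α), L.head? = some s → L.getLast? = some t → C s → ¬ C t →
      ∃ a b, C a ∧ ¬ C b ∧ [a, b] <:+: L := by
  intro L
  induction L with
  | nil => intro s t h; simp at h
  | cons x L ih =>
    intro s t hs ht hCs hCt
    simp only [List.head?_cons, Option.some.injEq] at hs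
    subst hs
    cases L with
    | nil => simp at ht; subst ht; exact absurd hCs hCt
    | cons y L =>
      by_cases hy : C y
      · obtain ⟨a, b, ha, hb, hab⟩ := ih y t rfl (by simpa using ht) hy hCt
        exact ⟨a, b, ha, hb, hab.trans (List.suffix_cons x _).isInfix⟩
      · exact ⟨x, y, hCs, hy, (List.prefix_append [x, y] L).isInfix⟩

open Classical in
lemma final_bound {n d : ℕ} (A : MAlgo n d) (q : ℕ) (s t : Fin n)
    (hD : 0 ≤ (n : ℝ) * d - 1 - 2 * d * q) :
    ((n : ℝ) * d - 1 - 2 * d * q) * ((Finset.univ.filter (fun f : PMatching n d =>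
      ¬ connD (mRun A f q) s t ∧ IsValidMeta f s t (A.output (mRun A f q)))).card : ℝ) ≤
      (d : ℝ) ^ 2 * ((1 : ℕ) : ℝ) * (Fintype.card (PMatching n d) : ℝ) := by
  refine event_bound A q _ (fun f : PMatching n d =>
      ¬ connD (mRun A f q) s t ∧ IsValidMeta f s t (A.output (mRun A f q))) hD ?_
  intro f0
  by_cases hex : ∃ a b, connD (mRun A f0 q) s a ∧ ¬ connD (mRun A f0 q) s b ∧
      [a, b] <:+: A.output (mRun A f0 q)
  · obtain ⟨a, b, ha, hb, hab⟩ := hex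
    refine ⟨a, {b}, by simp, ?_⟩
    rintro f hf ⟨-, -, -, hch⟩
    rw [hf] at hch ⊢
    have h2 := List.IsChain.infix hch hab
    have h3 : metaAdj f a b := by simpa using h2
    obtain ⟨j, hj⟩ := h3
    refine ⟨j, by simp [hj], fun hdisc => hb ?_⟩
    rw [hj] at hdisc
    exact Relation.ReflTransGen.tail ha hdisc
  · refine ⟨s, ∅, by simp, ?_⟩
    rintro f hf ⟨h1, h2, h3, -⟩
    rw [hf] at h1 h2 h3
    exact absurd (exists_hop (connD (mRun A f0 q) s) (fun _ _ => True) _ s t h2 h3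
      Relation.ReflTransGen.refl h1) hex

open Classical in
lemma conn_bound {n d : ℕ} (A : MAlgo n d) (q : ℕ) (s t : Fin n) (hst : s ≠ t)
    (D : ℝ) (hD0 : 0 ≤ D) (hd : 0 < d) :
    ∀ m : ℕ, D ≤ (n : ℝ) * d - 1 - 2 * d * m →
    D * ((Finset.univ.filter (fun f : PMatching n d => connD (mRun A f m) s t)).card : ℝ) ≤
      (d : ℝ) ^ 3 * (m : ℝ) ^ 2 * (Fintype.card (PMatching n d) : ℝ) := by
  intro m
  induction m with
  | zero =>
    intro _
    have : (Finset.univ.filter (fun f : PMatching n d => connD (mRun A f 0) s t)) = ∅ := by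
      apply Finset.filter_eq_empty_iff.2
      intro f _ hc
      rcases Relation.ReflTransGen.cases_tail hc with h1 | ⟨b, _, e, he, _⟩
      · exact hst h1.symm
      · simp [mRun] at he
    rw [this]; simp
  | succ m ih =>
    intro hD
    have hd1 : (1 : ℝ) ≤ d := by exact_mod_cast hd
    have hm0 : (0 : ℝ) ≤ m := Nat.cast_nonneg _
    push_cast at hD
    have hDm : D ≤ (n : ℝ) * d - 1 - 2 * d * m := by nlinarith
    have h1 := ih hDm
    have h2 := step_bound A m s t (hD0.trans hDm)
    have hsub : (Finset.univ.filter (fun f : PMatching n d => connD (mRun A f (m + 1)) s t)) ⊆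
        (Finset.univ.filter (fun f : PMatching n d => connD (mRun A f m) s t)) ∪
        (Finset.univ.filter (fun f : PMatching n d =>
          ¬ connD (mRun A f m) s t ∧ connD (mRun A f (m + 1)) s t)) := by
      intro f hf
      simp only [Finset.mem_union, Finset.mem_filter, Finset.mem_univ, true_and] at hf ⊢
      tauto
    have h3 := (Finset.card_le_card hsub).trans (Finset.card_union_le _ _)
    have h3' : ((Finset.univ.filter (fun f : PMatching n d =>
          connD (mRun A f (m + 1)) s t)).card : ℝ) ≤
        ((Finset.univ.filter (fun f : PMatching n d => connD (mRun A f m) s t)).card : ℝ) +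
        ((Finset.univ.filter (fun f : PMatching n d =>
          ¬ connD (mRun A f m) s t ∧ connD (mRun A f (m + 1)) s t)).card : ℝ) := by
      exact_mod_cast h3
    have h4 := mul_le_mul_of_nonneg_left h3' hD0
    rw [mul_add] at h4
    have h5 := mul_le_mul_of_nonneg_right hDm (Nat.cast_nonneg (α := ℝ)
      (Finset.univ.filter (fun f : PMatching n d =>
          ¬ connD (mRun A f m) s t ∧ connD (mRun A f (m + 1)) s t)).card)
    have hM : (0 : ℝ) ≤ (Fintype.card (PMatching n d) : ℝ) := Nat.cast_nonneg _
    have h6 : (d : ℝ) ^ 3 * (m : ℝ) ^ 2 + (d : ℝ) ^ 2 * ((1 + m * (d + 1) : ℕ) : ℝ) ≤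
        (d : ℝ) ^ 3 * ((m + 1 : ℕ) : ℝ) ^ 2 := by
      push_cast
      have : (1 : ℝ) + m * (d + 1) ≤ d * (2 * m + 1) := by nlinarith
      nlinarith [mul_le_mul_of_nonneg_left this (sq_nonneg (d : ℝ))]
    have h7 := mul_le_mul_of_nonneg_right h6 hM
    rw [add_mul] at h7
    linarith

/-- Let `n, d ≥ 1` with `nd` even, let `G` be a uniformly random perfect matching from
`M_{n,d}`, and let `q` satisfy `2dq < nd − 1`.  Every deterministic adaptive algorithm
making at most `q` group-incidence queries and then outputting a meta-path from `s = 1`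
(group `0` of `Fin n`) to `t = n` (group `n−1`) outputs a valid meta-path with probability
at most `d²/(nd − 1 − 2dq) + d³q²/(nd − 1 − 2dq)`. -/
theorem stmt12 (n d q : ℕ) (hn : 0 < n) (hd : 0 < d) (heven : Even (n * d))
    (hq : (2 * d * q : ℝ) < (n : ℝ) * d - 1) (A : MAlgo n d) :
    mProb n d (fun f =>
        IsValidMeta f ⟨0, by omega⟩ ⟨n - 1, by omega⟩ (A.output (mRun A f q)))
      ≤ (d : ℝ) ^ 2 / ((n : ℝ) * d - 1 - 2 * d * q)
        + (d : ℝ) ^ 3 * (q : ℝ) ^ 2 / ((n : ℝ) * d - 1 - 2 * d * q) := by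
  classical
  set D := (n : ℝ) * d - 1 - 2 * d * q with hDdef
  have hD : 0 < D := by linarith
  have hd1 : (1 : ℝ) ≤ d := by exact_mod_cast hd
  set s : Fin n := ⟨0, by omega⟩ with hs
  set t : Fin n := ⟨n - 1, by omega⟩ with ht
  unfold mProb
  rw [Nat.card_eq_fintype_card, Nat.card_eq_fintype_card, Fintype.card_subtype, ← add_div]
  set M := (Fintype.card (PMatching n d) : ℝ) with hM
  have hM0 : 0 ≤ M := Nat.cast_nonneg _
  apply div_le_of_le_mul₀ hM0 (by positivity)
  rw [div_mul_eq_mul_div, le_div_iff₀ hD]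
  have hq0 : (0 : ℝ) ≤ q := Nat.cast_nonneg _
  by_cases hst : s = t
  · have hn1 : n = 1 := by
      have := congrArg Fin.val hst
      simp only [hs, ht] at this
      omega
    have hle : ((Finset.univ.filter (fun f : PMatching n d =>
        IsValidMeta f s t (A.output (mRun A f q)))).card : ℝ) ≤ M := by
      rw [hM]; exact_mod_cast Finset.card_le_univ _
    have hDd : D ≤ (d : ℝ) ^ 2 + (d : ℝ) ^ 3 * (q : ℝ) ^ 2 := by
      have h1 : D ≤ d := by
        rw [hDdef, hn1]; push_cast; nlinarith
      have h2 : (0 : ℝ) ≤ (d : ℝ) ^ 3 * (q : ℝ) ^ 2 := by positivity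
      nlinarith
    calc _ ≤ M * D := mul_le_mul_of_nonneg_right hle hD.le
      _ ≤ M * ((d : ℝ) ^ 2 + (d : ℝ) ^ 3 * (q : ℝ) ^ 2) := mul_le_mul_of_nonneg_left hDd hM0
      _ = _ := mul_comm _ _
  · have h1 := final_bound A q s t hD.le
    have h2 := conn_bound A q s t hst D hD.le hd q le_rfl
    have hsub : (Finset.univ.filter (fun f : PMatching n d =>
        IsValidMeta f s t (A.output (mRun A f q)))) ⊆
        (Finset.univ.filter (fun f : PMatching n d =>
          ¬ connD (mRun A f q) s t ∧ IsValidMeta f s t (A.output (mRun A f q)))) ∪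
        (Finset.univ.filter (fun f : PMatching n d => connD (mRun A f q) s t)) := by
      intro f hf
      simp only [Finset.mem_union, Finset.mem_filter, Finset.mem_univ, true_and] at hf ⊢
      tauto
    have h3 := (Finset.card_le_card hsub).trans (Finset.card_union_le _ _)
    have h3' : ((Finset.univ.filter (fun f : PMatching n d =>
        IsValidMeta f s t (A.output (mRun A f q)))).card : ℝ) ≤
        ((Finset.univ.filter (fun f : PMatching n d =>
          ¬ connD (mRun A f q) s t ∧ IsValidMeta f s t (A.output (mRun A f q)))).card : ℝ) +
        ((Finset.univ.filter (fun f : PMatching n d => connD (mRun A f q) s t)).card : ℝ) := by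
      exact_mod_cast h3
    have h4 := mul_le_mul_of_nonneg_left h3' hD.le
    rw [mul_add] at h4
    rw [← hDdef, ← hM] at h1
    rw [← hM] at h2
    rw [Nat.cast_one] at h1
    rw [mul_comm]
    refine le_trans ?_ (le_of_le_of_eq (h4.trans (add_le_add h1 h2)) (by ring))
    exact le_of_eq (by congr!)
end

section
/- There is an absolute constant C such that the following holds. Let d ≥ 3, let nd be even, let G be a uniformly random simple d-regular graph on n vertices, and let q satisfy 2dq < nd − 1. Then any (possibly randomized) algorithm making at most q node-incidence queries outputs a valid s-t path (s = 1, t = n) with probability at most e^{C·d²}·(d² + d³q²)/(nd − 1 − 2dq). In particular, for d = O(1), any algorithm making o(√n) node-incidence queries outputs a valid s-t path with probability o(1). -/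
namespace Stmt15Aux

variable {n d : ℕ}

def nb (g : RegGraph n d) (v : Fin n) : Finset (Fin n) :=
  Finset.univ.filter fun u => g.1 v u = true

theorem mem_nb (g : RegGraph n d) (v u : Fin n) : u ∈ nb g v ↔ g.1 v u = true := by
  simp [nb]

theorem card_nb (g : RegGraph n d) (v : Fin n) : (nb g v).card = d := g.2.2.2 v

def qs (h : List (Fin n × Finset (Fin n))) : Finset (Fin n) := (h.map Prod.fst).toFinset

/-- the four flipped pairs -/
def fl (a b c e u v : Fin n) : Bool :=
  decide ((u = a ∧ v = b) ∨ (u = b ∧ v = a) ∨ (u = c ∧ v = e) ∨ (u = e ∧ v = c) ∨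
    (u = a ∧ v = c) ∨ (u = c ∧ v = a) ∨ (u = b ∧ v = e) ∨ (u = e ∧ v = b))

theorem card_row_swap (f f' : Fin n → Bool) (x y : Fin n)
    (h : ∀ u, f' u = f (Equiv.swap x y u)) :
    (Finset.univ.filter fun u => f' u = true).card =
      (Finset.univ.filter fun u => f u = true).card := by
  refine Finset.card_bij (fun u _ => Equiv.swap x y u) ?_ ?_ ?_
  · intro u hu
    simpa [h] using hu
  · intro u _ v _ huv
    exact (Equiv.swap x y).injective huv
  · intro v hv
    refine ⟨Equiv.swap x y v, ?_, by simp⟩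
    simpa [h] using hv

theorem row_flip (f f' : Fin n → Bool) (x y : Fin n) (hx : f x = true) (hy : f y = false)
    (h : ∀ u, f' u = (f u ^^ decide (u = x ∨ u = y))) :
    (Finset.univ.filter fun u => f' u = true).card =
      (Finset.univ.filter fun u => f u = true).card := by
  apply card_row_swap f f' x y
  intro u
  rw [h]
  by_cases h1 : u = x
  · subst h1; simp [hx, hy]
  by_cases h2 : u = y
  · subst h2; simp [hx, hy]
  simp [h1, h2, Equiv.swap_apply_of_ne_of_ne h1 h2]

/-- a legal switching -/
structure Legal (g : RegGraph n d) (a b c e : Fin n) : Prop where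
  ab : g.1 a b = true
  ce : g.1 c e = true
  ca : c ≠ a
  eb : e ≠ b
  ac : g.1 a c = false
  be : g.1 b e = false

theorem Legal.ne {g : RegGraph n d} {a b c e : Fin n} (h : Legal g a b c e) :
    a ≠ b ∧ c ≠ e ∧ c ≠ b ∧ e ≠ a := by
  obtain ⟨h1, h2, h3, h4, h5, h6⟩ := h
  have hs := g.2.1
  have hi := g.2.2.1
  refine ⟨?_, ?_, ?_, ?_⟩
  · rintro rfl; simp [hi] at h1
  · rintro rfl; simp [hi] at h2
  · rintro rfl; simp [h1] at h5
  · rintro rfl; rw [hs] at h6; simp [h1] at h6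

def switch (g : RegGraph n d) (a b c e : Fin n) (h : Legal g a b c e) : RegGraph n d :=
  ⟨fun u v => (g.1 u v ^^ fl a b c e u v), by
    have hs := g.2.1
    have hi := g.2.2.1
    obtain ⟨n1, n2, n3, n4⟩ := h.ne
    obtain ⟨h1, h2, h3, h4, h5, h6⟩ := h
    refine ⟨?_, ?_, ?_⟩
    · intro u v
      beta_reduce
      rw [hs u v]
      congr 1
      unfold fl
      congr 1
      apply propext
      tauto
    · intro v
      simp only [hi, fl]
      simp
      grind
    · intro v
      refine Eq.trans ?_ (g.2.2.2 v)
      have h1' := hs a b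
      have h2' := hs c e
      have h5' := hs a c
      have h6' := hs b e
      by_cases va : v = a
      · subst va
        apply row_flip _ _ b c h1 h5
        intro u; beta_reduce; congr 1; unfold fl; congr 1; apply propext; grind
      by_cases vb : v = b
      · subst vb
        apply row_flip _ _ a e (by grind) h6
        intro u; beta_reduce; congr 1; unfold fl; congr 1; apply propext; grind
      by_cases vc : v = c
      · subst vc
        apply row_flip _ _ e a h2 (by grind)
        intro u; beta_reduce; congr 1; unfold fl; congr 1; apply propext; grind
      by_cases ve : v = e
      · subst ve
        apply row_flip _ _ c b (by grind) (by grind)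
        intro u; beta_reduce; congr 1; unfold fl; congr 1; apply propext; grind
      congr 1
      ext u
      simp [fl, va, vb, vc, ve]⟩

theorem switch_row (g : RegGraph n d) (a b c e : Fin n) (h : Legal g a b c e) (v : Fin n)
    (va : v ≠ a) (vb : v ≠ b) (vc : v ≠ c) (ve : v ≠ e) (u : Fin n) :
    (switch g a b c e h).1 v u = g.1 v u := by
  simp [switch, fl, va, vb, vc, ve]

theorem switch_ac (g : RegGraph n d) (a b c e : Fin n) (h : Legal g a b c e) :
    (switch g a b c e h).1 a c = true := by
  simp [switch, fl, h.ac]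

theorem switch_be (g : RegGraph n d) (a b c e : Fin n) (h : Legal g a b c e) :
    (switch g a b c e h).1 b e = true := by
  simp [switch, fl, h.be]

theorem switch_inj (g g' : RegGraph n d) (a b c e : Fin n) (h : Legal g a b c e)
    (h' : Legal g' a b c e) (heq : switch g a b c e h = switch g' a b c e h') : g = g' := by
  apply Subtype.ext
  funext u v
  have := congrFun (congrFun (congrArg Subtype.val heq) u) v
  simpa [switch] using this

theorem switch_inj' (g g' : RegGraph n d) (p p' : Fin n × Fin n) (c e : Fin n)
    (h : Legal g p.1 p.2 c e) (h' : Legal g' p'.1 p'.2 c e) (hp : p = p')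
    (heq : switch g p.1 p.2 c e h = switch g' p'.1 p'.2 c e h') : g = g' := by
  subst hp
  exact switch_inj _ _ _ _ _ _ _ _ heq

theorem qs_succ (A : NAlgo n) (g : RegGraph n d) (i : ℕ) :
    qs (nRun A g (i + 1)) = insert (A.nextQuery (nRun A g i)) (qs (nRun A g i)) := by
  ext x
  simp only [qs, nRun]
  simp

theorem card_qs (A : NAlgo n) (g : RegGraph n d) (i : ℕ) :
    (qs (nRun A g i)).card ≤ i := by
  induction i with
  | zero => simp [qs, nRun]
  | succ i ih =>
    rw [qs_succ]
    exact (Finset.card_insert_le _ _).trans (by omega)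

theorem run_congr (A : NAlgo n) (g g' : RegGraph n d) (i : ℕ)
    (h : ∀ v ∈ qs (nRun A g i), ∀ u, g'.1 v u = g.1 v u) : nRun A g' i = nRun A g i := by
  induction i with
  | zero => rfl
  | succ i ih =>
    have h1 := ih (fun v hv => h v (by rw [qs_succ]; exact Finset.mem_insert_of_mem hv))
    have h2 := h (A.nextQuery (nRun A g i)) (by rw [qs_succ]; exact Finset.mem_insert_self _ _)
    simp only [nRun]
    rw [h1]
    simp [h2]

def goodCE (g : RegGraph n d) (Q : Finset (Fin n)) (a b : Fin n) :
    Finset (Σ _ : Fin n, Fin n) :=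
  (Finset.univ.sigma (nb g)).filter fun p =>
    p.1 ∉ Q ∧ p.2 ∉ Q ∧ p.1 ≠ a ∧ p.2 ≠ b ∧ g.1 a p.1 = false ∧ g.1 b p.2 = false

theorem card_goodCE (g : RegGraph n d) (Q : Finset (Fin n)) (a b : Fin n) (i : ℕ)
    (hQ : Q.card ≤ i) : n * d - (2 * d * i + 2 * d * (d + 1)) ≤ (goodCE g Q a b).card := by
  classical
  have hB : ∀ x, (Q ∪ insert x (nb g x)).card ≤ i + (d + 1) := by
    intro x
    refine (Finset.card_union_le _ _).trans (Nat.add_le_add hQ ?_)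
    refine (Finset.card_insert_le _ _).trans ?_
    rw [card_nb]
  have hsig : ∀ B : Finset (Fin n), (B.sigma (nb g)).card = B.card * d := by
    intro B
    simp [Finset.card_sigma, card_nb]
  have htot : (Finset.univ.sigma (nb g)).card = n * d := by rw [hsig]; simp
  let F : (Σ _ : Fin n, Fin n) → (Σ _ : Fin n, Fin n) := fun p => ⟨p.2, p.1⟩
  have hsub : Finset.univ.sigma (nb g) ⊆ goodCE g Q a b ∪
      ((Q ∪ insert a (nb g a)).sigma (nb g) ∪
        ((Q ∪ insert b (nb g b)).sigma (nb g)).image F) := by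
    rintro ⟨c, e⟩ hce
    have hg : g.1 c e = true := by simpa [mem_nb] using hce
    have hg' : g.1 e c = true := by rw [g.2.1]; exact hg
    by_cases h1 : c ∈ Q ∪ insert a (nb g a)
    · apply Finset.mem_union_right
      apply Finset.mem_union_left
      rw [Finset.mem_sigma]
      exact ⟨h1, by simpa [mem_nb] using hg⟩
    by_cases h2 : e ∈ Q ∪ insert b (nb g b)
    · apply Finset.mem_union_right
      apply Finset.mem_union_right
      rw [Finset.mem_image]
      refine ⟨⟨e, c⟩, ?_, rfl⟩
      rw [Finset.mem_sigma]
      exact ⟨h2, by simpa [mem_nb] using hg'⟩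
    · apply Finset.mem_union_left
      simp only [goodCE, Finset.mem_filter]
      simp only [Finset.mem_union, Finset.mem_insert, mem_nb, not_or, Bool.not_eq_true] at h1 h2
      exact ⟨hce, h1.1, h2.1, h1.2.1, h2.2.1, h1.2.2, h2.2.2⟩
  have h1 := Finset.card_le_card hsub
  have h2 := h1.trans ((Finset.card_union_le _ _).trans (Nat.add_le_add_left
    ((Finset.card_union_le _ _).trans (Nat.add_le_add_left Finset.card_image_le _)) _))
  rw [htot, hsig, hsig] at h2
  have h3 := Nat.mul_le_mul_right d (hB a)
  have h4 := Nat.mul_le_mul_right d (hB b)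
  have h5 : 2 * d * i + 2 * d * (d + 1) = (i + (d + 1)) * d + (i + (d + 1)) * d := by ring
  omega

theorem key (A : NAlgo n) (i m : ℕ) (S : List (Fin n × Finset (Fin n)) → Finset (Fin n × Fin n))
    (hS : ∀ g : RegGraph n d, (S (nRun A g i)).card ≤ m) :
    Nat.card {g : RegGraph n d // ∃ p ∈ S (nRun A g i), p.1 ∉ qs (nRun A g i) ∧
      p.2 ∉ qs (nRun A g i) ∧ g.1 p.1 p.2 = true} * (n * d - (2 * d * i + 2 * d * (d + 1)))
      ≤ m * d ^ 2 * Nat.card (RegGraph n d) := by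
  classical
  set Bad : RegGraph n d → Prop := fun g => ∃ p ∈ S (nRun A g i), p.1 ∉ qs (nRun A g i) ∧
      p.2 ∉ qs (nRun A g i) ∧ g.1 p.1 p.2 = true with hBad
  let P : {g // Bad g} → Fin n × Fin n := fun g => Classical.choose g.2
  have hP : ∀ g, P g ∈ S (nRun A g.1 i) ∧ (P g).1 ∉ qs (nRun A g.1 i) ∧
      (P g).2 ∉ qs (nRun A g.1 i) ∧ g.1.1 (P g).1 (P g).2 = true :=
    fun g => Classical.choose_spec g.2
  let X : Finset (Σ _ : {g // Bad g}, Σ _ : Fin n, Fin n) :=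
    Finset.univ.sigma fun g => goodCE g.1 (qs (nRun A g.1 i)) (P g).1 (P g).2
  let Y : Finset (Σ _ : RegGraph n d, Σ _ : Fin n × Fin n, Fin n × Fin n) :=
    Finset.univ.sigma fun g => (S (nRun A g i)).sigma fun p => nb g p.1 ×ˢ nb g p.2
  have hX : Nat.card {g // Bad g} * (n * d - (2 * d * i + 2 * d * (d + 1))) ≤ X.card := by
    rw [Finset.card_sigma]
    have := Finset.card_nsmul_le_sum (Finset.univ : Finset {g // Bad g})
      (fun g => (goodCE g.1 (qs (nRun A g.1 i)) (P g).1 (P g).2).card)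
      (n * d - (2 * d * i + 2 * d * (d + 1)))
      (fun g _ => card_goodCE _ _ _ _ _ (card_qs A g.1 i))
    simpa [Nat.card_eq_fintype_card] using this
  have hY : Y.card ≤ m * d ^ 2 * Nat.card (RegGraph n d) := by
    rw [Finset.card_sigma]
    have := Finset.sum_le_card_nsmul (Finset.univ : Finset (RegGraph n d))
      (fun g => ((S (nRun A g i)).sigma fun p => nb g p.1 ×ˢ nb g p.2).card) (m * d ^ 2)
      (fun g _ => by
        simp only [Finset.card_sigma, Finset.card_product, card_nb, Finset.sum_const, smul_eq_mul]
        rw [← pow_two]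
        exact Nat.mul_le_mul_right _ (hS g))
    rw [Nat.card_eq_fintype_card, mul_comm]
    simpa using this
  refine hX.trans (le_trans ?_ hY)
  have hL : ∀ x ∈ X, Legal x.1.1 (P x.1).1 (P x.1).2 x.2.1 x.2.2 ∧
      x.2.1 ∉ qs (nRun A x.1.1 i) ∧ x.2.2 ∉ qs (nRun A x.1.1 i) := by
    rintro ⟨g, c, e⟩ hx
    simp only [X, Finset.mem_sigma, goodCE, Finset.mem_filter, mem_nb] at hx
    obtain ⟨_, ⟨_, h1⟩, h2, h3, h4, h5, h6, h7⟩ := hx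
    exact ⟨⟨(hP g).2.2.2, h1, h4, h5, h6, h7⟩, h2, h3⟩
  have hrun : ∀ x (hx : x ∈ X), nRun A (switch _ _ _ _ _ (hL x hx).1) i = nRun A x.1.1 i := by
    intro x hx
    apply run_congr
    intro v hv u
    have h0 := hP x.1
    have h1 := hL x hx
    apply switch_row
    · rintro rfl; exact h0.2.1 hv
    · rintro rfl; exact h0.2.2.1 hv
    · rintro rfl; exact h1.2.1 hv
    · rintro rfl; exact h1.2.2 hv
  refine Finset.card_le_card_of_injOn (fun x => if hx : x ∈ X then
    ⟨switch _ _ _ _ _ (hL x hx).1, P x.1, (x.2.1, x.2.2)⟩ else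
      ⟨x.1.1, P x.1, (x.2.1, x.2.2)⟩) ?_ ?_
  · intro x hx
    have hx' : x ∈ X := hx
    simp only [hx', dif_pos]
    simp only [Y, Finset.mem_coe, Finset.mem_sigma, Finset.mem_univ, true_and,
      Finset.mem_product, mem_nb]
    refine ⟨?_, switch_ac _ _ _ _ _ _, switch_be _ _ _ _ _ _⟩
    rw [hrun x hx']
    exact (hP x.1).1
  · intro x hx y hy hxy
    have hx' : x ∈ X := hx
    have hy' : y ∈ X := hy
    simp only [hx', hy', dif_pos] at hxy
    have hLx := (hL x hx').1
    have hLy := (hL y hy').1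
    have h1 := congrArg Sigma.fst hxy
    have h2 : P x.1 = P y.1 := congrArg (fun z => z.2.1) hxy
    have h3 : (x.2.1, x.2.2) = (y.2.1, y.2.2) := congrArg (fun z => z.2.2) hxy
    obtain ⟨gx, cx, ex⟩ := x
    obtain ⟨gy, cy, ey⟩ := y
    simp only [Prod.mk.injEq] at h3
    obtain ⟨rfl, rfl⟩ := h3
    simp only at h1 h2 hLx hLy
    have : gx.1 = gy.1 := by
      exact switch_inj' _ _ _ _ _ _ _ _ h2 h1
    obtain rfl : gx = gy := Subtype.ext this
    rfl

/-- touched vertices -/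
def touched (s t : Fin n) (h : List (Fin n × Finset (Fin n))) : Finset (Fin n) :=
  {s, t} ∪ (h.toFinset.biUnion Prod.snd)

theorem touched_succ (A : NAlgo n) (g : RegGraph n d) (s t : Fin n) (i : ℕ) :
    touched s t (nRun A g (i + 1)) =
      touched s t (nRun A g i) ∪ nb g (A.nextQuery (nRun A g i)) := by
  ext x
  simp only [touched, nRun, nb]
  simp only [List.toFinset_append, Finset.mem_union, Finset.mem_biUnion]
  simp
  grind

theorem card_touched (A : NAlgo n) (g : RegGraph n d) (s t : Fin n) (i : ℕ) :
    (touched s t (nRun A g i)).card ≤ 2 + d * i := by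
  induction i with
  | zero => simpa [touched, nRun] using Finset.card_le_two
  | succ i ih =>
    rw [touched_succ]
    refine (Finset.card_union_le _ _).trans ?_
    rw [card_nb]
    linarith

theorem nb_sub_touched (A : NAlgo n) (g : RegGraph n d) (s t : Fin n) (i : ℕ) (x y : Fin n)
    (hx : x ∈ qs (nRun A g i)) (hxy : g.1 x y = true) : y ∈ touched s t (nRun A g i) := by
  induction i with
  | zero => simp [qs, nRun] at hx
  | succ i ih =>
    rw [touched_succ, Finset.mem_union]
    rw [qs_succ, Finset.mem_insert] at hx
    rcases hx with rfl | hx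
    · right; rwa [mem_nb]
    · left; exact ih hx

/-- candidate collisions at a step -/
def stepS (A : NAlgo n) (s t : Fin n) (h : List (Fin n × Finset (Fin n))) :
    Finset (Fin n × Fin n) :=
  (touched s t h).image fun u => (A.nextQuery h, u)

def Bad (A : NAlgo n) (S : List (Fin n × Finset (Fin n)) → Finset (Fin n × Fin n)) (i : ℕ)
    (g : RegGraph n d) : Prop :=
  ∃ p ∈ S (nRun A g i), p.1 ∉ qs (nRun A g i) ∧ p.2 ∉ qs (nRun A g i) ∧ g.1 p.1 p.2 = true

theorem cut (A : NAlgo n) (g : RegGraph n d) (s t : Fin n) (hst : s ≠ t) (q : ℕ)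
    (h : ∀ i < q, ¬ Bad A (stepS A s t) i g) :
    ∃ P : Fin n → Prop, P s ∧ ¬ P t ∧
      ∀ x ∈ qs (nRun A g q), ∀ y, g.1 x y = true → (P x ↔ P y) := by
  induction q with
  | zero => exact ⟨fun x => x = s, rfl, fun h => hst h.symm, by simp [qs, nRun]⟩
  | succ q ih =>
    obtain ⟨P, hs, ht, hP⟩ := ih (fun i hi => h i (by omega))
    have hb := h q (by omega)
    rw [qs_succ]
    set v := A.nextQuery (nRun A g q) with hv
    by_cases hvQ : v ∈ qs (nRun A g q)
    · rw [Finset.insert_eq_of_mem hvQ]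
      exact ⟨P, hs, ht, hP⟩
    have hnew : ∀ u, u ∉ qs (nRun A g q) → g.1 v u = true → u ∉ touched s t (nRun A g q) := by
      intro u hu hgu hT
      exact hb ⟨(v, u), Finset.mem_image.2 ⟨u, hT, rfl⟩, hvQ, hu, hgu⟩
    have hsT : s ∈ touched s t (nRun A g q) := by simp [touched]
    have htT : t ∈ touched s t (nRun A g q) := by simp [touched]
    have hvv := g.2.2.1 v
    have hsymm := g.2.1
    refine ⟨fun x => if x ∉ qs (nRun A g q) ∧ g.1 v x = true then P v else P x, ?_, ?_, ?_⟩
    · have : ¬ (s ∉ qs (nRun A g q) ∧ g.1 v s = true) := fun hh => hnew s hh.1 hh.2 hsT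
      simpa only [this, if_false] using hs
    · have : ¬ (t ∉ qs (nRun A g q) ∧ g.1 v t = true) := fun hh => hnew t hh.1 hh.2 htT
      simpa only [this, if_false] using ht
    · intro x hx y hxy
      have hx1 : (if x ∉ qs (nRun A g q) ∧ g.1 v x = true then P v else P x) ↔ P x := by
        rcases Finset.mem_insert.1 hx with rfl | hx
        · simp
        · simp [hx]
      refine hx1.trans ?_
      beta_reduce
      rcases Finset.mem_insert.1 hx with rfl | hx
      · by_cases hy : y ∈ qs (nRun A g q)
        · have := hP y hy v (by rw [hsymm]; exact hxy)
          simp [hy, this]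
        · simp [hy, hxy]
      · have hyT := nb_sub_touched A g s t q x y hx hxy
        have : ¬ (y ∉ qs (nRun A g q) ∧ g.1 v y = true) := fun hh => hnew y hh.1 hh.2 hyT
        simp only [this, if_false]
        exact hP x hx y hxy

open Classical in
/-- guess of an unqueried edge on the output path -/
noncomputable def finS (A : NAlgo n) (h : List (Fin n × Finset (Fin n))) :
    Finset (Fin n × Fin n) :=
  if hh : ∃ p : Fin n × Fin n, [p.1, p.2] <:+: A.output h ∧ p.1 ∉ qs h ∧ p.2 ∉ qs h then
    {Classical.choose hh} else ∅

theorem card_finS (A : NAlgo n) (h : List (Fin n × Finset (Fin n))) : (finS A h).card ≤ 1 := by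
  unfold finS
  split_ifs <;> simp

theorem infix_chain {α : Type*} (R : α → α → Prop) (L : List α) (h : L.IsChain R) (a b : α)
    (hi : [a, b] <:+: L) : R a b := by
  have := h.infix hi
  simpa using this

theorem chain_end {α : Type*} (P : α → Prop) (L : List α)
    (h : ∀ a b, [a, b] <:+: L → (P a ↔ P b)) (s t : α) (hs : L.head? = some s)
    (ht : L.getLast? = some t) (hPs : P s) : P t := by
  induction L generalizing s with
  | nil => simp at hs
  | cons x L ih =>
    simp at hs
    subst hs
    cases L with
    | nil => simp at ht; exact ht ▸ hPs
    | cons y L =>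
      have hxy := h x y ⟨[], L, by simp⟩
      refine ih (fun a b hab => h a b (hab.trans (List.suffix_cons _ _).isInfix)) y rfl ?_
        (hxy.1 hPs)
      simpa using ht

theorem cover (A : NAlgo n) (g : RegGraph n d) (s t : Fin n) (hst : s ≠ t) (q : ℕ)
    (hv : IsValidPathReg g s t (A.output (nRun A g q))) :
    Bad A (finS A) q g ∨ ∃ i ∈ Finset.range q, Bad A (stepS A s t) i g := by
  by_contra hcon
  push Not at hcon
  obtain ⟨h1, h2⟩ := hcon
  obtain ⟨P, hs, ht, hP⟩ := cut A g s t hst q (fun i hi => h2 i (Finset.mem_range.2 hi))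
  obtain ⟨v1, v2, v3⟩ := hv
  apply ht
  refine chain_end P _ ?_ s t v1 v2 hs
  intro a b hab
  have hgab : g.1 a b = true := infix_chain _ _ v3 a b hab
  by_cases ha : a ∈ qs (nRun A g q)
  · exact hP a ha b hgab
  by_cases hb : b ∈ qs (nRun A g q)
  · exact (hP b hb a (by rw [g.2.1]; exact hgab)).symm
  exfalso
  apply h1
  have hh : ∃ p : Fin n × Fin n, [p.1, p.2] <:+: A.output (nRun A g q) ∧
    p.1 ∉ qs (nRun A g q) ∧ p.2 ∉ qs (nRun A g q) := ⟨(a, b), hab, ha, hb⟩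
  have hc := Classical.choose_spec hh
  refine ⟨Classical.choose hh, ?_, hc.2.1, hc.2.2, infix_chain _ _ v3 _ _ hc.1⟩
  unfold finS
  rw [dif_pos hh]
  simp

theorem count (A : NAlgo n) (s t : Fin n) (hst : s ≠ t) (q : ℕ) :
    Nat.card {g : RegGraph n d // IsValidPathReg g s t (A.output (nRun A g q))} *
      (n * d - (2 * d * q + 2 * d * (d + 1))) ≤
      (1 + q * (2 + d * q)) * d ^ 2 * Nat.card (RegGraph n d) := by
  classical
  set M := n * d - (2 * d * q + 2 * d * (d + 1)) with hM
  have e : ∀ p : RegGraph n d → Prop, Nat.card {g // p g} = (Finset.univ.filter p).card := by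
    intro p
    rw [Nat.card_eq_fintype_card, Fintype.card_subtype]
  have hsub : (Finset.univ.filter fun g : RegGraph n d =>
      IsValidPathReg g s t (A.output (nRun A g q))) ⊆
      (Finset.univ.filter (Bad A (finS A) q)) ∪
        (Finset.range q).biUnion fun i => Finset.univ.filter (Bad A (stepS A s t) i) := by
    intro g hg
    have := cover A g s t hst q (by simpa using hg)
    simpa using this
  have h1 := (Finset.card_le_card hsub).trans ((Finset.card_union_le _ _).trans
    (Nat.add_le_add_left Finset.card_biUnion_le _))
  rw [e]
  refine (Nat.mul_le_mul_right M h1).trans ?_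
  rw [add_mul, Finset.sum_mul]
  have k1 : (Finset.univ.filter (Bad (d := d) A (finS A) q)).card * M ≤
      1 * d ^ 2 * Nat.card (RegGraph n d) := by
    rw [← e]
    exact key A q 1 (finS A) (fun g => card_finS A _)
  have k2 : ∀ i ∈ Finset.range q, (Finset.univ.filter (Bad (d := d) A (stepS A s t) i)).card * M ≤
      (2 + d * q) * d ^ 2 * Nat.card (RegGraph n d) := by
    intro i hi
    have hiq := (Finset.mem_range.1 hi).le
    rw [← e]
    refine le_trans (Nat.mul_le_mul_left _ ?_) (key A i (2 + d * q) (stepS A s t) (fun g => ?_))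
    · have := Nat.mul_le_mul_left (2 * d) hiq
      omega
    · refine Finset.card_image_le.trans ((card_touched A g s t i).trans ?_)
      have := Nat.mul_le_mul_left d hiq
      omega
  have k3 := Finset.sum_le_card_nsmul _ _ _ k2
  simp only [Finset.card_range, smul_eq_mul] at k3
  calc _ ≤ _ := Nat.add_le_add k1 k3
    _ = _ := by ring

theorem prob_bound (q : ℕ) (hd : 3 ≤ d) (A : NAlgo n) (s t : Fin n) (hst : s ≠ t)
    (hq : (2 * d * q : ℝ) < (n : ℝ) * d - 1) :
    regProb n d (fun g => IsValidPathReg g s t (A.output (nRun A g q))) ≤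
      Real.exp (1 * (d : ℝ) ^ 2) * ((d : ℝ) ^ 2 + (d : ℝ) ^ 3 * (q : ℝ) ^ 2)
            / ((n : ℝ) * d - 1 - 2 * d * q) := by
  have hc := count (d := d) A s t hst q
  unfold regProb
  set N := Nat.card (RegGraph n d) with hN
  set V := Nat.card {g : RegGraph n d // IsValidPathReg g s t (A.output (nRun A g q))} with hV
  have hVN : V ≤ N := Nat.card_le_card_of_injective _ Subtype.val_injective
  have hdR : (3 : ℝ) ≤ d := by exact_mod_cast hd
  have hD : (0 : ℝ) < (n : ℝ) * d - 1 - 2 * d * q := by linarith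
  set D : ℝ := (n : ℝ) * d - 1 - 2 * d * q with hDd
  have hexp : (10 : ℝ) ≤ Real.exp (1 * (d : ℝ) ^ 2) := by
    have := Real.add_one_le_exp (1 * (d : ℝ) ^ 2)
    nlinarith
  have hq0 : (0 : ℝ) ≤ q := Nat.cast_nonneg q
  have hpos : 0 ≤ (d : ℝ) ^ 3 * (q : ℝ) ^ 2 := by positivity
  have hE : 10 * ((d : ℝ) ^ 2 + (d : ℝ) ^ 3 * (q : ℝ) ^ 2) ≤
      Real.exp (1 * (d : ℝ) ^ 2) * ((d : ℝ) ^ 2 + (d : ℝ) ^ 3 * (q : ℝ) ^ 2) :=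
    mul_le_mul_of_nonneg_right hexp (by positivity)
  rw [le_div_iff₀ hD]
  refine le_trans ?_ hE
  rcases Nat.eq_zero_or_pos N with h0 | hNpos
  · rw [h0]; simp; positivity
  have hNR : (0 : ℝ) < N := by exact_mod_cast hNpos
  have hVNR : (V : ℝ) ≤ N := by exact_mod_cast hVN
  rw [div_mul_eq_mul_div, div_le_iff₀ hNR]
  by_cases hbig : D ≤ 4 * d * (d + 1)
  · have h1 : (V : ℝ) * D ≤ N * D := mul_le_mul_of_nonneg_right hVNR hD.le
    have h2 : D ≤ 10 * ((d : ℝ) ^ 2 + (d : ℝ) ^ 3 * (q : ℝ) ^ 2) := by nlinarith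
    nlinarith
  push Not at hbig
  have hle : 2 * d * q + 2 * d * (d + 1) ≤ n * d := by
    have : (2 * d * q + 2 * d * (d + 1) : ℝ) ≤ n * d := by nlinarith
    exact_mod_cast this
  have hcR : (V : ℝ) * ((n : ℝ) * d - (2 * d * q + 2 * d * (d + 1))) ≤
      (1 + q * (2 + d * q)) * d ^ 2 * N := by
    have : ((V * (n * d - (2 * d * q + 2 * d * (d + 1))) : ℕ) : ℝ) ≤
      (((1 + q * (2 + d * q)) * d ^ 2 * N : ℕ) : ℝ) := by exact_mod_cast hc
    rw [Nat.cast_mul, Nat.cast_sub hle] at this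
    push_cast at this
    exact this
  have hV0 : (0 : ℝ) ≤ V := Nat.cast_nonneg V
  have h3 : (V : ℝ) * D ≤ 2 * ((V : ℝ) * ((n : ℝ) * d - (2 * d * q + 2 * d * (d + 1)))) := by
    have : D ≤ 2 * ((n : ℝ) * d - (2 * d * q + 2 * d * (d + 1))) := by nlinarith
    nlinarith
  have h4 : 2 * ((1 + (q : ℝ) * (2 + d * q)) * d ^ 2) ≤
      10 * ((d : ℝ) ^ 2 + (d : ℝ) ^ 3 * (q : ℝ) ^ 2) := by
    have h5 : 2 * (1 + (q : ℝ) * (2 + d * q)) ≤ 10 * (1 + d * (q : ℝ) ^ 2) := by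
      nlinarith [sq_nonneg ((q : ℝ) - 1), sq_nonneg (q : ℝ)]
    have h6 := mul_le_mul_of_nonneg_right h5 (sq_nonneg (d : ℝ))
    nlinarith
  have h7 := mul_le_mul_of_nonneg_right h4 hNR.le
  linarith

end Stmt15Aux

/-- There is an absolute constant `C` such that: for `d ≥ 3`, `nd` even, a uniformly
random simple `d`-regular graph `G` on `n` vertices, and `q` with `2dq < nd − 1`, any
possibly randomized algorithm (modeled by a finite randomness source `Ω` with weights `ρ`
and a deterministic algorithm `Alg r` for each seed `r`) making at most `q` node-incidence
queries outputs a valid `s`-`t` path (`s = 1`, i.e. vertex `0` of `Fin n`, `t = n`, i.e.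
vertex `n−1`) with probability at most `e^{C·d²}·(d² + d³·q²)/(nd − 1 − 2dq)`.
(In particular, for `d = O(1)`, any algorithm making `o(√n)` node-incidence queries
outputs a valid `s`-`t` path with probability `o(1)`.) -/
theorem stmt15 : ∃ C : ℝ,
    ∀ (n d q : ℕ) (hd : 3 ≤ d) (hdn : d < n) (heven : Even (n * d))
      (hq : (2 * d * q : ℝ) < (n : ℝ) * d - 1)
      (Ω : Type) (_ : Fintype Ω) (ρ : Ω → ℝ) (hρ : ∀ r, 0 ≤ ρ r) (hsum : ∑ r, ρ r = 1)
      (Alg : Ω → NAlgo n),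
      ∑ r, ρ r * regProb n d (fun g =>
          IsValidPathReg g ⟨0, by omega⟩ ⟨n - 1, by omega⟩
            ((Alg r).output (nRun (Alg r) g q)))
        ≤ Real.exp (C * (d : ℝ) ^ 2) * ((d : ℝ) ^ 2 + (d : ℝ) ^ 3 * (q : ℝ) ^ 2)
            / ((n : ℝ) * d - 1 - 2 * d * q) := by
  refine ⟨1, ?_⟩
  intro n d q hd hdn heven hq Ω _ ρ hρ hsum Alg
  refine le_trans (Finset.sum_le_sum fun r _ => mul_le_mul_of_nonneg_left
    (Stmt15Aux.prob_bound q hd (Alg r) _ _ ?_ hq) (hρ r)) ?_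
  · intro h
    have := congrArg Fin.val h
    simp at this
    omega
  · rw [← Finset.sum_mul, hsum, one_mul]
end
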